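/- arXiv:2409.07068 — 6 statements merged into one kernel-verified Lean document; each statement's English description precedes it below -/
import Mathlib

section
/- Let φ ↦ ρ_φ be a family of d×d complex density matrices, differentiable in the real parameter φ, whose rank is constant in φ, and let q be an integer with q ≥ rank ρ_φ. Then J(ρ_φ) = 4 · inf ∑_{i=1}^q ⟨ψ̇_{φ₀,i}|ψ̇_{φ₀,i}⟩, where J is the purification-based quantum Fisher information at φ₀ and the infimum is over all differentiable families of vectors ψ_{φ,1},…,ψ_{φ,q} ∈ ℂ^d satisfying ∑_{i=1}^q |ψ_{φ,i}⟩⟨ψ_{φ,i}| = ρ_φ for all φ. -/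
open Matrix BigOperators
open scoped ComplexOrder

/-- The purification-based quantum Fisher information of a differentiable family of
density matrices at the point `φ₀`. -/
noncomputable def QFI {d : ℕ} (ρ : ℝ → Matrix (Fin d) (Fin d) ℂ) (φ₀ : ℝ) : ℝ :=
  sInf { x : ℝ | ∃ (m : ℕ) (Ψ : ℝ → Fin d × Fin m → ℂ),
    (∀ i, Differentiable ℝ (fun φ => Ψ φ i)) ∧
    (∀ φ a b, (∑ k : Fin m, Ψ φ (a, k) * star (Ψ φ (b, k))) = ρ φ a b) ∧
    x = 4 * ∑ i, ‖deriv (fun φ => Ψ φ i) φ₀‖ ^ 2 }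


/-- A differentiable one-parameter family of nonzero complex matrices admits a vector that lies in
none of the kernels. -/
theorem exists_forall_mulVec_ne_zero {d : ℕ} (ρ : ℝ → Matrix (Fin d) (Fin d) ℂ)
    (hdiff : ∀ a b, Differentiable ℝ (fun φ => ρ φ a b)) (hne : ∀ φ, ρ φ ≠ 0) :
    ∃ v : Fin d → ℂ, ∀ φ, ρ φ *ᵥ v ≠ 0 := by
  -- Solving one row of `ρ φ *ᵥ v = 0` for a coordinate of `v` exhibits the vectors to be avoided as
  -- the image of a map whose derivative is everywhere singular.
  let F : Fin d → Fin d → (Fin d → ℂ) → Fin d → ℂ := fun a j w =>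
    Function.update w j
      (-(∑ k ∈ Finset.univ.erase j, ρ (w j).re a k * w k) / ρ (w j).re a j)
  let S : Fin d → Fin d → Set (Fin d → ℂ) := fun a j => {w | ρ (w j).re a j ≠ 0}
  have hnull : ∀ a j, MeasureTheory.volume (Set.image (F a j) (S a j)) = 0 := by
    intro a j
    have hF : ∀ w ∈ S a j, DifferentiableAt ℝ (F a j) w := by
      intro w hw
      have hre : DifferentiableAt ℝ (fun w : Fin d → ℂ => (w j).re) w :=
        (Complex.reCLM.comp
          (ContinuousLinearMap.proj (R := ℝ) (φ := fun _ : Fin d => ℂ) j)).differentiableAt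
      have hρ : ∀ k, DifferentiableAt ℝ (fun w : Fin d → ℂ => ρ (w j).re a k) w := fun k =>
        ((hdiff a k) (w j).re).comp (f := fun w : Fin d → ℂ => (w j).re) w hre
      rw [differentiableAt_pi]
      intro k
      by_cases hk : k = j
      · subst hk
        simp only [F, Function.update_self]
        simp only [div_eq_mul_inv]
        refine DifferentiableAt.mul ?_ ((hρ k).inv hw)
        refine DifferentiableAt.neg (DifferentiableAt.fun_sum fun l _ => ?_)
        exact (hρ l).mul (differentiableAt_apply l w)
      · simp only [F, Function.update_of_ne hk]
        exact differentiableAt_apply k w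
    refine MeasureTheory.addHaar_image_eq_zero_of_det_fderivWithin_eq_zero MeasureTheory.volume
      (f' := fun w => fderiv ℝ (F a j) w) (fun w hw => (hF w hw).hasFDerivAt.hasFDerivWithinAt) ?_
    intro w hw
    have hinv : ∀ s : ℝ, F a j (w + s • (Pi.single j Complex.I : Fin d → ℂ)) = F a j w := by
      intro s
      have hre : ((w + s • (Pi.single j Complex.I : Fin d → ℂ)) j).re = (w j).re := by simp
      ext k
      by_cases hk : k = j
      · subst hk
        simp only [F, Function.update_self, hre]
        congr 2
        refine Finset.sum_congr rfl fun l hl => ?_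
        simp [Finset.ne_of_mem_erase hl]
      · simp [F, hk]
    have hker : fderiv ℝ (F a j) w (Pi.single j Complex.I) = 0 := by
      have h := (hF w hw).hasFDerivAt.hasLineDerivAt (Pi.single j Complex.I)
      simp only [HasLineDerivAt, hinv] at h
      exact h.unique (hasDerivAt_const _ _)
    rw [ContinuousLinearMap.det, LinearMap.det_eq_zero_iff_ker_ne_bot]
    intro hbot
    have hmem : (Pi.single j Complex.I : Fin d → ℂ) ∈
        LinearMap.ker ((fderiv ℝ (F a j) w : (Fin d → ℂ) →L[ℝ] (Fin d → ℂ)) :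
          (Fin d → ℂ) →ₗ[ℝ] (Fin d → ℂ)) := hker
    rw [hbot, Submodule.mem_bot] at hmem
    simpa using congrFun hmem j
  have hU : MeasureTheory.volume (⋃ a, ⋃ j, Set.image (F a j) (S a j)) = 0 := by
    simp only [MeasureTheory.measure_iUnion_null_iff]
    exact hnull
  obtain ⟨v, hv⟩ : ∃ v, v ∉ ⋃ a, ⋃ j, Set.image (F a j) (S a j) := by
    by_contra! h
    rw [Set.eq_univ_of_forall h] at hU
    exact (MeasureTheory.Measure.measure_univ_ne_zero.2 (NeZero.ne _)) hU
  refine ⟨v, fun φ hφ => hv ?_⟩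
  obtain ⟨a, j, haj⟩ : ∃ a j, ρ φ a j ≠ 0 := by
    by_contra! h
    exact hne φ (Matrix.ext h)
  simp only [Set.mem_iUnion]
  refine ⟨a, j, Function.update v j (φ : ℂ), by simpa [S] using haj, ?_⟩
  have hrow : ρ φ a j * v j + ∑ k ∈ Finset.univ.erase j, ρ φ a k * v k = 0 := by
    rw [Finset.add_sum_erase _ (fun k => ρ φ a k * v k) (Finset.mem_univ j)]
    exact congrFun hφ a
  have hsum : ∑ k ∈ Finset.univ.erase j, ρ φ a k * Function.update v j (φ : ℂ) k =
      ∑ k ∈ Finset.univ.erase j, ρ φ a k * v k :=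
    Finset.sum_congr rfl fun k hk => by rw [Function.update_of_ne (Finset.ne_of_mem_erase hk)]
  simp only [F, Function.update_self, Function.update_idem, Complex.ofReal_re, hsum]
  rw [Function.update_eq_self_iff, div_eq_iff haj]
  linear_combination -hrow

theorem Matrix.rank_add_le_rank_add_rank {m n : Type*} [Fintype m] [Fintype n]
    (A B : Matrix m n ℂ) : (A + B).rank ≤ A.rank + B.rank := by
  have hle : LinearMap.range (A + B).mulVecLin ≤
      LinearMap.range A.mulVecLin ⊔ LinearMap.range B.mulVecLin := by
    rintro _ ⟨w, rfl⟩
    rw [mulVecLin_add]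
    exact Submodule.add_mem_sup ⟨w, rfl⟩ ⟨w, rfl⟩
  exact (Submodule.finrank_mono hle).trans (Submodule.finrank_add_le_finrank_add_finrank _ _)

/-- Subtracting the rank-one part of a positive semidefinite matrix along a vector outside its
kernel leaves a positive semidefinite matrix of rank smaller by one. -/
theorem Matrix.PosSemidef.sub_vecMulVec_mulVec {n : Type*} [Fintype n] [DecidableEq n]
    {A : Matrix n n ℂ} (hA : A.PosSemidef) {v : n → ℂ} (hv : A *ᵥ v ≠ 0) :
    (A - (star v ⬝ᵥ (A *ᵥ v))⁻¹ • vecMulVec (A *ᵥ v) (star (A *ᵥ v))).PosSemidef ∧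
    (A - (star v ⬝ᵥ (A *ᵥ v))⁻¹ • vecMulVec (A *ᵥ v) (star (A *ᵥ v))).rank + 1 = A.rank := by
  set s := star v ⬝ᵥ (A *ᵥ v) with hs
  have hs0 : s ≠ 0 := fun h => hv ((hA.dotProduct_mulVec_zero_iff v).1 h)
  have hsstar : star s = s := (IsSelfAdjoint.of_nonneg (hA.dotProduct_mulVec_nonneg v)).star_eq
  set P := vecMulVec v (star v) with hP
  have hstar : star (A *ᵥ v) = star v ᵥ* A := by rw [star_mulVec, hA.isHermitian.eq]
  have hAPA : vecMulVec (A *ᵥ v) (star (A *ᵥ v)) = A * P * A := by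
    rw [hstar, hP, mul_vecMulVec, vecMulVec_mul]
  have hPAP : P * A * P = s • P := by
    rw [hP, vecMulVec_mul, vecMulVec_mul_vecMulVec, ← dotProduct_mulVec, vecMulVec_smul]
  have hPH : Pᴴ = P := by rw [hP, conjTranspose_vecMulVec, star_star]
  set C := A - s⁻¹ • vecMulVec (A *ᵥ v) (star (A *ᵥ v)) with hC
  have hconj : C = (1 - s⁻¹ • (P * A))ᴴ * A * (1 - s⁻¹ • (P * A)) := by
    have h3 : A * P * A * P * A = s • (A * P * A) := by
      have := congrArg (fun X => A * X * A) hPAP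
      simpa [Matrix.mul_assoc] using this
    have h4 : (1 - s⁻¹ • (P * A))ᴴ = 1 - s⁻¹ • (A * P) := by
      simp [hPH, hA.isHermitian.eq, hsstar]
    rw [h4, hC, hAPA]
    simp only [sub_mul, mul_sub, one_mul, mul_one, smul_mul_assoc, mul_smul_comm, ← Matrix.mul_assoc,
      h3, smul_smul, inv_mul_cancel₀ hs0]
    simp
  have hCpos : C.PosSemidef := hconj ▸ hA.conjTranspose_mul_mul_same _
  refine ⟨hCpos, ?_⟩
  have hle : A.rank ≤ C.rank + 1 := by
    have h1 : A = C + vecMulVec (s⁻¹ • (A *ᵥ v)) (star (A *ᵥ v)) := by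
      rw [smul_vecMulVec, hC]; abel
    calc A.rank = (C + vecMulVec (s⁻¹ • (A *ᵥ v)) (star (A *ᵥ v))).rank := by rw [← h1]
      _ ≤ C.rank + (vecMulVec (s⁻¹ • (A *ᵥ v)) (star (A *ᵥ v))).rank := Matrix.rank_add_le_rank_add_rank _ _
      _ ≤ C.rank + 1 := by gcongr; exact rank_vecMulVec_le _ _
  have hCv : C *ᵥ v = 0 := by
    rw [hC, sub_mulVec, smul_mulVec, vecMulVec_mulVec, hstar, ← dotProduct_mulVec, ← hs]
    ext i
    simp [hs0]
  have hlt : C.rank < A.rank := by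
    have hker : LinearMap.ker A.mulVecLin < LinearMap.ker C.mulVecLin := by
      refine lt_of_le_of_ne (fun w hw => ?_) fun h => hv ?_
      · rw [LinearMap.mem_ker, mulVecLin_apply] at hw ⊢
        rw [hC, hAPA, sub_mulVec, smul_mulVec, ← mulVec_mulVec, hw]
        simp
      · have : v ∈ LinearMap.ker C.mulVecLin := hCv
        rw [← h] at this
        exact this
    have h1 := Submodule.finrank_lt_finrank_of_lt hker
    have h2 := A.mulVecLin.finrank_range_add_finrank_ker
    have h3 := C.mulVecLin.finrank_range_add_finrank_ker
    simp only [Matrix.rank]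
    omega
  omega

/-- A differentiable family of positive semidefinite matrices of constant rank `r` factors
differentiably as `B φ * (B φ)ᴴ`, where `B φ` has `r` columns. -/
theorem exists_differentiable_mul_conjTranspose_eq {d : ℕ} (r : ℕ)
    (ρ : ℝ → Matrix (Fin d) (Fin d) ℂ)
    (hdiff : ∀ a b, Differentiable ℝ (fun φ => ρ φ a b))
    (hpos : ∀ φ, (ρ φ).PosSemidef) (hrank : ∀ φ, (ρ φ).rank = r) :
    ∃ B : ℝ → Matrix (Fin d) (Fin r) ℂ, (∀ a k, Differentiable ℝ (fun φ => B φ a k)) ∧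
      ∀ φ, B φ * (B φ)ᴴ = ρ φ := by
  induction r generalizing ρ with
  | zero =>
    refine ⟨fun _ => 0, fun _ k => k.elim0, fun φ => ?_⟩
    have h : ρ φ = 0 := by
      have h := hrank φ
      rw [Matrix.rank, Submodule.finrank_eq_zero, LinearMap.range_eq_bot] at h
      exact toLin'.injective (by rw [toLin'_apply', h, map_zero])
    simp [h]
  | succ r ih =>
    obtain ⟨v, hv⟩ := exists_forall_mulVec_ne_zero ρ hdiff fun φ h => by
      have := hrank φ
      simp [h] at this
    let s : ℝ → ℂ := fun φ => star v ⬝ᵥ (ρ φ *ᵥ v)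
    have hs : ∀ φ, ((s φ).re : ℂ) = s φ := fun φ =>
      Complex.conj_eq_iff_re.1 (IsSelfAdjoint.of_nonneg ((hpos φ).dotProduct_mulVec_nonneg v)).star_eq
    have hspos : ∀ φ, 0 < (s φ).re := fun φ => by
      have h0 : s φ ≠ 0 := fun h => hv φ (((hpos φ).dotProduct_mulVec_zero_iff v).1 h)
      have h1 : 0 ≤ (s φ).re := (Complex.nonneg_iff.1 ((hpos φ).dotProduct_mulVec_nonneg v)).1
      refine lt_of_le_of_ne h1 fun h => h0 ?_
      rw [← hs φ, ← h, Complex.ofReal_zero]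
    have hmv : ∀ a, Differentiable ℝ (fun φ => (ρ φ *ᵥ v) a) := fun a => by
      simp only [mulVec, dotProduct]
      exact Differentiable.fun_sum fun k _ => (hdiff a k).mul_const (v k)
    have hsdiff : Differentiable ℝ s :=
      Differentiable.fun_sum fun k _ => (hmv k).const_mul (star v k)
    let c : ℝ → ℂ := fun φ => ((√(s φ).re)⁻¹ : ℝ)
    have hcdiff : Differentiable ℝ c := fun φ => by
      have h1 : DifferentiableAt ℝ (fun φ => (s φ).re) φ :=
        Complex.reCLM.differentiableAt.comp φ (hsdiff φ)
      exact Complex.ofRealCLM.differentiableAt.comp φ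
        ((h1.sqrt (hspos φ).ne').inv (Real.sqrt_pos.2 (hspos φ)).ne')
    have hcc : ∀ φ, c φ * star (c φ) = (s φ)⁻¹ := fun φ => by
      simp only [c, Complex.star_def, Complex.conj_ofReal]
      rw [← Complex.ofReal_mul, ← mul_inv, Real.mul_self_sqrt (hspos φ).le, Complex.ofReal_inv, hs]
    let b : ℝ → Fin d → ℂ := fun φ => c φ • (ρ φ *ᵥ v)
    have hbdiff : ∀ a, Differentiable ℝ (fun φ => b φ a) := fun a => hcdiff.mul (hmv a)
    have hbb : ∀ φ, vecMulVec (b φ) (star (b φ)) =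
        (s φ)⁻¹ • vecMulVec (ρ φ *ᵥ v) (star (ρ φ *ᵥ v)) := fun φ => by
      simp only [b, star_smul, smul_vecMulVec, vecMulVec_smul, smul_smul, ← hcc, mul_comm]
    have key := fun φ => (hpos φ).sub_vecMulVec_mulVec (hv φ)
    obtain ⟨B, hB, hBB⟩ := ih (fun φ => ρ φ - vecMulVec (b φ) (star (b φ)))
      (fun a k => (hdiff a k).sub ((hbdiff a).mul (hbdiff k).star))
      (fun φ => by rw [hbb]; exact (key φ).1)
      (fun φ => by
        have h := (key φ).2
        rw [hrank] at h
        rw [hbb]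
        exact Nat.succ_injective h)
    refine ⟨fun φ => Matrix.of fun a => Fin.cons (b φ a) (B φ a), fun a k => ?_, fun φ => ?_⟩
    · refine Fin.cases ?_ (fun k => ?_) k
      · exact hbdiff a
      · exact hB a k
    · ext i j
      have h := congrFun (congrFun (hBB φ) i) j
      rw [Matrix.mul_apply, Matrix.sub_apply, vecMulVec_apply] at h
      rw [Matrix.mul_apply, Fin.sum_univ_succ]
      simp only [conjTranspose_apply, of_apply, Fin.cons_zero, Fin.cons_succ, Pi.star_apply] at h ⊢
      rw [h]
      ring

theorem hasDerivAt_matrix_mul_apply {l m n : Type*} [Fintype m] {f : ℝ → Matrix l m ℂ}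
    {g : ℝ → Matrix m n ℂ} {f' : Matrix l m ℂ} {g' : Matrix m n ℂ} {t : ℝ}
    (hf : ∀ i j, HasDerivAt (fun s => f s i j) (f' i j) t)
    (hg : ∀ i j, HasDerivAt (fun s => g s i j) (g' i j) t) (i : l) (j : n) :
    HasDerivAt (fun s => (f s * g s) i j) ((f' * g t + f t * g') i j) t := by
  simp only [Matrix.mul_apply, Matrix.add_apply, ← Finset.sum_add_distrib]
  exact HasDerivAt.fun_sum fun k _ => (hf i k).mul (hg k j)

theorem differentiable_matrix_mul_apply {l m n : Type*} [Fintype m] {f : ℝ → Matrix l m ℂ}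
    {g : ℝ → Matrix m n ℂ} (hf : ∀ i j, Differentiable ℝ (fun s => f s i j))
    (hg : ∀ i j, Differentiable ℝ (fun s => g s i j)) (i : l) (j : n) :
    Differentiable ℝ (fun s => (f s * g s) i j) := by
  simp only [Matrix.mul_apply]
  exact Differentiable.fun_sum fun k _ => (hf i k).mul (hg k j)

theorem trace_mul_conjTranspose_eq_sum_norm_sq {m n : Type*} [Fintype m] [Fintype n]
    (X : Matrix m n ℂ) : (X * Xᴴ).trace = ((∑ i, ∑ j, ‖X i j‖ ^ 2 : ℝ) : ℂ) := by
  push_cast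
  refine Finset.sum_congr rfl fun i _ => ?_
  rw [Matrix.diag_apply, Matrix.mul_apply]
  exact Finset.sum_congr rfl fun j _ => Complex.mul_conj' (X i j)

/-- Right multiplication by the adjoint of a coisometry does not increase the Frobenius norm. -/
theorem sum_norm_sq_mul_conjTranspose_le {l m n : Type*} [Fintype l] [Fintype m] [Fintype n]
    [DecidableEq m] [DecidableEq n] (X : Matrix l n ℂ) {W : Matrix m n ℂ} (hW : W * Wᴴ = 1) :
    ∑ i, ∑ j, ‖(X * Wᴴ) i j‖ ^ 2 ≤ ∑ i, ∑ j, ‖X i j‖ ^ 2 := by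
  have hsplit : X * Xᴴ = (X * Wᴴ) * (X * Wᴴ)ᴴ + (X * (1 - Wᴴ * W)) * (X * (1 - Wᴴ * W))ᴴ := by
    have h : Wᴴ * W * (Wᴴ * W) = Wᴴ * W := by
      rw [Matrix.mul_assoc, ← Matrix.mul_assoc W, hW, Matrix.one_mul]
    have h' : (1 - Wᴴ * W) * (1 - Wᴴ * W) = 1 - Wᴴ * W := by
      rw [Matrix.sub_mul, Matrix.mul_sub, Matrix.mul_sub, h]; simp
    have h1 : X * (1 - Wᴴ * W) * (X * (1 - Wᴴ * W))ᴴ = X * (1 - Wᴴ * W) * Xᴴ := by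
      rw [conjTranspose_mul, conjTranspose_sub, conjTranspose_mul, conjTranspose_conjTranspose,
        conjTranspose_one, ← Matrix.mul_assoc, Matrix.mul_assoc X, h']
    rw [h1, conjTranspose_mul, conjTranspose_conjTranspose, Matrix.mul_sub, Matrix.sub_mul]
    simp [Matrix.mul_assoc]
  have htr := congrArg Matrix.trace hsplit
  rw [Matrix.trace_add] at htr
  simp only [trace_mul_conjTranspose_eq_sum_norm_sq] at htr
  have hre : ∑ i, ∑ j, ‖X i j‖ ^ 2 = ∑ i, ∑ j, ‖(X * Wᴴ) i j‖ ^ 2 +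
      ∑ i, ∑ j, ‖(X * (1 - Wᴴ * W) : Matrix l n ℂ) i j‖ ^ 2 := by exact_mod_cast htr
  rw [hre]
  exact le_add_of_nonneg_right (by positivity)

section

attribute [local instance] Matrix.linftyOpNormedRing Matrix.linftyOpNormedAlgebra
  Matrix.linftyOpNormedAddCommGroup Matrix.linftyOpNormedSpace

/-- Every skew-Hermitian matrix is the velocity at `t` of a differentiable family of unitary
matrices passing through the identity at `t`. -/
theorem exists_unitary_family_hasDerivAt {n : Type*} [Fintype n] [DecidableEq n]
    {K : Matrix n n ℂ} (hK : Kᴴ = -K) (t : ℝ) :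
    ∃ U : ℝ → Matrix n n ℂ, (∀ i j, Differentiable ℝ (fun s => U s i j)) ∧
      (∀ s, U s * (U s)ᴴ = 1) ∧ U t = 1 ∧
      ∀ i j, HasDerivAt (fun s => U s i j) (K i j) t := by
  let U : ℝ → Matrix n n ℂ := fun s => NormedSpace.exp ((s - t) • K)
  have hderiv : ∀ s, HasDerivAt U (U s * K) s := fun s =>
    (hasDerivAt_exp_smul_const (𝕂 := ℝ) K (s - t)).comp_sub_const s t
  have happly : ∀ s i j, HasDerivAt (fun s => U s i j) ((U s * K) i j) s := fun s i j => by
    let L : Matrix n n ℂ →L[ℝ] ℂ := LinearMap.toContinuousLinearMap (Matrix.entryLinearMap ℝ ℂ i j)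
    exact L.hasFDerivAt.comp_hasDerivAt s (hderiv s)
  have hUt : U t = 1 := by simp [U, NormedSpace.exp_zero]
  refine ⟨U, fun i j s => (happly s i j).differentiableAt, fun s => ?_, hUt, fun i j => ?_⟩
  · have h : ((s - t) • K)ᴴ = -((s - t) • K) := by
      rw [conjTranspose_smul, hK, star_trivial, smul_neg]
    simp only [U]
    rw [← Matrix.exp_conjTranspose, h, ← Matrix.exp_add_of_commute _ _ 
      (Commute.refl ((s - t) • K)).neg_right,
      add_neg_cancel, NormedSpace.exp_zero]
  · simpa [hUt] using happly t i j

end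

/-- Factorizations `B * Bᴴ = A * Aᴴ` with `B` of full column rank differ by a coisometry. -/
theorem exists_coisometry_of_mul_conjTranspose_eq {l m n : Type*} [Fintype l] [Fintype m]
    [Fintype n] [DecidableEq l] [DecidableEq m] {B : Matrix l m ℂ} {A : Matrix l n ℂ}
    (hB : IsUnit (Bᴴ * B).det) (h : B * Bᴴ = A * Aᴴ) :
    ∃ W : Matrix m n ℂ, W * Wᴴ = 1 ∧ B * W = A := by
  set G := Bᴴ * B with hG
  have hGH : Gᴴ = G := by simp [hG]
  have hl : G⁻¹ * G = 1 := nonsing_inv_mul _ hB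
  have hr : G * G⁻¹ = 1 := mul_nonsing_inv _ hB
  have hW : (G⁻¹ * Bᴴ * A)ᴴ = Aᴴ * B * G⁻¹ := by
    simp [conjTranspose_nonsing_inv, hGH, Matrix.mul_assoc]
  refine ⟨G⁻¹ * Bᴴ * A, ?_, ?_⟩
  · calc (G⁻¹ * Bᴴ * A) * (G⁻¹ * Bᴴ * A)ᴴ = G⁻¹ * Bᴴ * (A * Aᴴ) * B * G⁻¹ := by
          rw [hW]; simp only [Matrix.mul_assoc]
      _ = (G⁻¹ * G) * (G * G⁻¹) := by rw [← h, hG]; simp only [Matrix.mul_assoc]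
      _ = 1 := by rw [hl, hr, one_mul]
  · have hPB : (1 - B * G⁻¹ * Bᴴ) * B = 0 := by
      rw [Matrix.sub_mul, Matrix.one_mul, Matrix.mul_assoc, ← hG, Matrix.mul_assoc, hl,
        Matrix.mul_one, sub_self]
    have hPA : (1 - B * G⁻¹ * Bᴴ) * A = 0 := by
      rw [← self_mul_conjTranspose_eq_zero]
      set P := 1 - B * G⁻¹ * Bᴴ
      calc P * A * (P * A)ᴴ = P * (A * Aᴴ) * Pᴴ := by
            rw [conjTranspose_mul]; simp only [Matrix.mul_assoc]
        _ = P * B * Bᴴ * Pᴴ := by rw [← h]; simp only [Matrix.mul_assoc]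
        _ = 0 := by rw [hPB, Matrix.zero_mul, Matrix.zero_mul]
    rw [Matrix.sub_mul, Matrix.one_mul, sub_eq_zero] at hPA
    rw [← Matrix.mul_assoc, ← Matrix.mul_assoc, ← hPA]

/-- A solution of the linearized equation `D * Bᴴ + B * Dᴴ = 0`, with `B` of full column rank, is
an infinitesimal unitary rotation of `B`. -/
theorem exists_skewHermitian_of_mul_conjTranspose_add_eq_zero {l m : Type*} [Fintype l] [Fintype m]
    [DecidableEq m] {B D : Matrix l m ℂ}
    (hB : IsUnit (Bᴴ * B).det) (h : D * Bᴴ + B * Dᴴ = 0) :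
    ∃ K : Matrix m m ℂ, Kᴴ = -K ∧ B * K = D := by
  set G := Bᴴ * B with hG
  have hl : G⁻¹ * G = 1 := nonsing_inv_mul _ hB
  have hr : G * G⁻¹ = 1 := mul_nonsing_inv _ hB
  have hD : B * (-(Dᴴ * B * G⁻¹)) = D := by
    have h1 : D * Bᴴ = -(B * Dᴴ) := eq_neg_of_add_eq_zero_left h
    calc B * (-(Dᴴ * B * G⁻¹)) = -(B * Dᴴ) * (B * G⁻¹) := by
          simp [Matrix.mul_assoc]
      _ = D * (G * G⁻¹) := by rw [← h1, hG]; simp only [Matrix.mul_assoc]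
      _ = D := by rw [hr, Matrix.mul_one]
  set K := -(Dᴴ * B * G⁻¹) with hK
  refine ⟨K, ?_, hD⟩
  have h2 : B * (K + Kᴴ) * Bᴴ = 0 := by
    rw [← h, ← hD, conjTranspose_mul, Matrix.mul_add, Matrix.add_mul]
    simp only [Matrix.mul_assoc]
  have h3 : G * (K + Kᴴ) * G = 0 := by
    calc G * (K + Kᴴ) * G = Bᴴ * (B * (K + Kᴴ) * Bᴴ) * B := by
          rw [hG]; simp only [Matrix.mul_assoc]
      _ = 0 := by rw [h2, Matrix.mul_zero, Matrix.zero_mul]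
  have h4 : K + Kᴴ = 0 := by
    calc K + Kᴴ = (G⁻¹ * G) * (K + Kᴴ) * (G * G⁻¹) := by
          rw [hl, hr, Matrix.one_mul, Matrix.mul_one]
      _ = G⁻¹ * (G * (K + Kᴴ) * G) * G⁻¹ := by simp only [Matrix.mul_assoc]
      _ = 0 := by rw [h3, Matrix.mul_zero, Matrix.zero_mul]
  exact eq_neg_of_add_eq_zero_right h4

theorem isUnit_det_conjTranspose_mul_self {l m : Type*} [Fintype l] [Fintype m] [DecidableEq m]
    {B : Matrix l m ℂ} (hB : B.rank = Fintype.card m) : IsUnit (Bᴴ * B).det := by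
  rw [← isUnit_iff_isUnit_det, ← mulVec_injective_iff_isUnit]
  have hrange : LinearMap.range (Bᴴ * B).mulVecLin = ⊤ := by
    apply Submodule.eq_top_of_finrank_eq
    rw [Module.finrank_fintype_fun_eq_card, ← hB, ← rank_conjTranspose_mul_self, Matrix.rank]
  exact LinearMap.injective_iff_surjective.2 (LinearMap.range_eq_top.1 hrange)

/-- Any differentiable factorization of `ρ` can be replaced by one with `q` columns, `q` at least
the number of columns of a full-column-rank factorization, without increasing the norm of the
derivative at `t`. -/
theorem exists_factorization_sum_norm_sq_deriv_le {d r m q : ℕ} (hrq : r ≤ q)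
    {ρ : ℝ → Matrix (Fin d) (Fin d) ℂ} {B : ℝ → Matrix (Fin d) (Fin r) ℂ}
    {A : ℝ → Matrix (Fin d) (Fin m) ℂ} (t : ℝ) (hrank : (ρ t).rank = r)
    (hBdiff : ∀ a k, Differentiable ℝ (fun φ => B φ a k)) (hB : ∀ φ, B φ * (B φ)ᴴ = ρ φ)
    (hAdiff : ∀ a k, Differentiable ℝ (fun φ => A φ a k)) (hA : ∀ φ, A φ * (A φ)ᴴ = ρ φ) :
    ∃ X : ℝ → Matrix (Fin d) (Fin q) ℂ, (∀ a k, Differentiable ℝ (fun φ => X φ a k)) ∧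
      (∀ φ, X φ * (X φ)ᴴ = ρ φ) ∧
      ∑ a, ∑ k, ‖deriv (fun φ => X φ a k) t‖ ^ 2 ≤ ∑ a, ∑ k, ‖deriv (fun φ => A φ a k) t‖ ^ 2 := by
  let dA : Matrix (Fin d) (Fin m) ℂ := Matrix.of fun a k => deriv (fun φ => A φ a k) t
  let dB : Matrix (Fin d) (Fin r) ℂ := Matrix.of fun a k => deriv (fun φ => B φ a k) t
  have hdA : ∀ a k, HasDerivAt (fun φ => A φ a k) (dA a k) t := fun a k =>
    (hAdiff a k t).hasDerivAt
  have hdB : ∀ a k, HasDerivAt (fun φ => B φ a k) (dB a k) t := fun a k =>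
    (hBdiff a k t).hasDerivAt
  have hdet : IsUnit ((B t)ᴴ * B t).det := isUnit_det_conjTranspose_mul_self (by
    rw [← rank_self_mul_conjTranspose, hB, hrank, Fintype.card_fin])
  obtain ⟨W, hW, hBW⟩ := exists_coisometry_of_mul_conjTranspose_eq hdet ((hB t).trans (hA t).symm)
  have hlin : dA * (A t)ᴴ + A t * dAᴴ = dB * (B t)ᴴ + B t * dBᴴ := by
    ext i j
    have h1 := hasDerivAt_matrix_mul_apply hdA (g := fun φ => (A φ)ᴴ) (g' := dAᴴ)
      (fun i j => (hdA j i).star) i j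
    have h2 := hasDerivAt_matrix_mul_apply hdB (g := fun φ => (B φ)ᴴ) (g' := dBᴴ)
      (fun i j => (hdB j i).star) i j
    simp only [hA] at h1
    simp only [hB] at h2
    exact h1.unique h2
  obtain ⟨K, hK, hBK⟩ := exists_skewHermitian_of_mul_conjTranspose_add_eq_zero
      (D := dA * Wᴴ - dB) hdet (by
    rw [← hBW] at hlin
    simp only [conjTranspose_mul, conjTranspose_sub, conjTranspose_conjTranspose, Matrix.sub_mul,
      Matrix.mul_sub, Matrix.mul_assoc] at hlin ⊢
    rw [sub_add_sub_comm, hlin, sub_self])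
  obtain ⟨U, hUdiff, hU, hUt, hdU⟩ := exists_unitary_family_hasDerivAt hK t
  have hBU : ∀ i j, HasDerivAt (fun φ => (B φ * U φ) i j) ((dA * Wᴴ) i j) t := fun i j => by
    have h := hasDerivAt_matrix_mul_apply hdB hdU i j
    rwa [hUt, Matrix.mul_one, hBK, add_sub_cancel] at h
  let E : Matrix (Fin r) (Fin q) ℂ := (1 : Matrix (Fin q) (Fin q) ℂ).submatrix (Fin.castLE hrq) id
  have hE : E * Eᴴ = 1 := by
    ext i j
    simp [E, Matrix.mul_apply, Matrix.one_apply, eq_comm]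
  refine ⟨fun φ => B φ * U φ * E, differentiable_matrix_mul_apply
    (differentiable_matrix_mul_apply hBdiff hUdiff) fun i j => differentiable_const _,
    fun φ => ?_, ?_⟩
  · calc B φ * U φ * E * (B φ * U φ * E)ᴴ = B φ * (U φ * (E * Eᴴ) * (U φ)ᴴ) * (B φ)ᴴ := by
          simp only [conjTranspose_mul, Matrix.mul_assoc]
      _ = ρ φ := by rw [hE, Matrix.mul_one, hU, Matrix.mul_one, hB]
  · have hdX : ∀ a k, deriv (fun φ => (B φ * U φ * E) a k) t = (dA * Wᴴ * E) a k := fun a k => by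
      have h := (hasDerivAt_matrix_mul_apply hBU (g := fun _ => E) (g' := 0)
        (fun i j => hasDerivAt_const _ _) a k).deriv
      rwa [Matrix.mul_zero, add_zero] at h
    simp only [hdX]
    have hnorm : ∑ a, ∑ k, ‖(dA * Wᴴ * E) a k‖ ^ 2 = ∑ a, ∑ k, ‖(dA * Wᴴ) a k‖ ^ 2 := by
      have htr : (dA * Wᴴ * E * (dA * Wᴴ * E)ᴴ).trace = (dA * Wᴴ * (dA * Wᴴ)ᴴ).trace := by
        rw [conjTranspose_mul (dA * Wᴴ), Matrix.mul_assoc _ E, ← Matrix.mul_assoc E, hE,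
          Matrix.one_mul]
      simp only [trace_mul_conjTranspose_eq_sum_norm_sq] at htr
      exact_mod_cast htr
    rw [hnorm]
    exact sum_norm_sq_mul_conjTranspose_le dA hW

/-- For a differentiable family of density matrices of constant rank and any
`q ≥ rank ρ_φ`, the QFI equals `4` times the infimum of `∑ᵢ ⟨ψ̇_{φ₀,i}|ψ̇_{φ₀,i}⟩`
over all differentiable families of `q` vectors with `∑ᵢ |ψ_{φ,i}⟩⟨ψ_{φ,i}| = ρ_φ`. -/
theorem qfi_eq_inf_over_vector_decompositions {d : ℕ}
    (ρ : ℝ → Matrix (Fin d) (Fin d) ℂ) (φ₀ : ℝ)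
    (hdiff : ∀ a b, Differentiable ℝ (fun φ => ρ φ a b))
    (hdens : ∀ φ, (ρ φ).PosSemidef ∧ (ρ φ).trace = 1)
    (hrank : ∀ φ φ', (ρ φ).rank = (ρ φ').rank)
    (q : ℕ) (hq : ∀ φ, (ρ φ).rank ≤ q) :
    QFI ρ φ₀ = sInf { x : ℝ | ∃ ψ : ℝ → Fin q → Fin d → ℂ,
      (∀ i a, Differentiable ℝ (fun φ => ψ φ i a)) ∧
      (∀ φ a b, (∑ i : Fin q, ψ φ i a * star (ψ φ i b)) = ρ φ a b) ∧
      x = 4 * ∑ i : Fin q, ∑ a : Fin d, ‖deriv (fun φ => ψ φ i a) φ₀‖ ^ 2 } := by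
  have hrank' := fun φ => hrank φ φ₀
  obtain ⟨B, hBdiff, hB⟩ := exists_differentiable_mul_conjTranspose_eq (ρ φ₀).rank ρ hdiff
    (fun φ => (hdens φ).1) hrank'
  have key := fun (m : ℕ) (A : ℝ → Matrix (Fin d) (Fin m) ℂ) =>
    exists_factorization_sum_norm_sq_deriv_le (A := A) (hq φ₀) φ₀ rfl hBdiff hB
  have mul_conjTranspose_iff : ∀ {n : ℕ} (φ : ℝ) (X : Matrix (Fin d) (Fin n) ℂ),
      (∀ a b, ∑ k, X a k * star (X b k) = ρ φ a b) ↔ X * Xᴴ = ρ φ := fun φ X => by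
    simp only [← Matrix.ext_iff, Matrix.mul_apply, conjTranspose_apply]
  apply le_antisymm
  · refine csInf_le_csInf ⟨0, ?_⟩ ?_ ?_
    · rintro _ ⟨m, Ψ, -, -, rfl⟩
      positivity
    · obtain ⟨X, hXdiff, hX, -⟩ := key _ B hBdiff hB
      exact ⟨_, fun φ i a => X φ a i, fun i a => hXdiff a i,
        fun φ => (mul_conjTranspose_iff φ _).2 (hX φ), rfl⟩
    · rintro _ ⟨ψ, hψdiff, hψ, rfl⟩
      refine ⟨q, fun φ i => ψ φ i.2 i.1, fun i => hψdiff i.2 i.1, hψ, ?_⟩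
      rw [Fintype.sum_prod_type, Finset.sum_comm]
  · refine le_csInf ⟨_, _, fun φ i => B φ i.1 i.2, fun i => hBdiff i.1 i.2,
      fun φ => (mul_conjTranspose_iff φ _).2 (hB φ), rfl⟩ ?_
    rintro _ ⟨m, Ψ, hΨdiff, hΨ, rfl⟩
    obtain ⟨X, hXdiff, hX, hle⟩ := key m (fun φ => Matrix.of fun a k => Ψ φ (a, k))
      (fun a k => hΨdiff (a, k)) (fun φ => (mul_conjTranspose_iff φ _).1 (hΨ φ))
    refine csInf_le_of_le ⟨0, ?_⟩ ⟨fun φ i a => X φ a i, fun i a => hXdiff a i,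
      fun φ => (mul_conjTranspose_iff φ _).2 (hX φ), rfl⟩ ?_
    · rintro _ ⟨ψ, -, -, rfl⟩
      positivity
    · rw [Fintype.sum_prod_type, Finset.sum_comm]
      exact mul_le_mul_of_nonneg_left hle (by norm_num)
end

section
/- Let φ ↦ ρ_φ be a family of d×d complex density matrices, differentiable in the real parameter φ, fix φ₀, and let L be a Hermitian d×d matrix with ρ̇_{φ₀} = (1/2)(Lρ_{φ₀} + ρ_{φ₀}L). Let {v_j} be an orthonormal eigenbasis of L with L v_j = λ_j v_j, and set q_j(φ) := ⟨v_j|ρ_φ|v_j⟩. If q_j(φ₀) > 0 for every j, then the classical Fisher information of the measurement statistics in this basis satisfies ∑_j (q̇_j(φ₀))²/q_j(φ₀) = Tr[ρ_{φ₀}L²]; that is, measuring in the eigenbasis of the symmetric logarithmic derivative attains the quantum Fisher information. -/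
open Matrix BigOperators
open scoped ComplexOrder

/-- The trace of a matrix is the sum of its diagonal entries in any orthonormal basis. -/
theorem Matrix.trace_eq_sum_star_dotProduct_mulVec {n : Type*} [Fintype n] [DecidableEq n]
    (v : n → n → ℂ) (hv : ∀ j k, (∑ a, star (v j a) * v k a) = if j = k then 1 else 0)
    (M : Matrix n n ℂ) : M.trace = ∑ j, star (v j) ⬝ᵥ (M *ᵥ v j) := by
  have h₁ : (Matrix.of v)ᵀᴴ * (Matrix.of v)ᵀ = 1 := by
    ext j k
    simpa [Matrix.mul_apply, Matrix.one_apply] using hv j k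
  have h₂ := mul_eq_one_comm.mp h₁
  calc M.trace = ((Matrix.of v)ᵀᴴ * (M * (Matrix.of v)ᵀ)).trace := by
        rw [Matrix.trace_mul_comm, Matrix.mul_assoc, h₂, Matrix.mul_one]
    _ = _ := by
        simp [Matrix.trace, Matrix.mul_apply, dotProduct, Matrix.mulVec]

/-- A Hermitian matrix acts on the dual of an eigenvector by the same real eigenvalue. -/
theorem Matrix.IsHermitian.star_dotProduct_mulVec_eigenvector {n : Type*} [Fintype n]
    {L : Matrix n n ℂ} (hL : L.IsHermitian) {v : n → ℂ} {μ : ℝ}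
    (hv : L *ᵥ v = (μ : ℂ) • v) (w : n → ℂ) :
    star v ⬝ᵥ (L *ᵥ w) = μ * (star v ⬝ᵥ w) := by
  have h : star v ᵥ* L = (μ : ℂ) • star v := by
    rw [← hL.eq, ← Matrix.star_mulVec, hv, star_smul]
    simp
  rw [Matrix.dotProduct_mulVec, h, smul_dotProduct, smul_eq_mul]

/-- Entrywise differentiation commutes with evaluating a sesquilinear form. -/
theorem HasDerivAt.dotProduct_mulVec_of_entries {n : Type*} [Fintype n]
    {ρ : ℝ → Matrix n n ℂ} {ρ' : Matrix n n ℂ} {x : ℝ}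
    (h : ∀ a b, HasDerivAt (fun t => ρ t a b) (ρ' a b) x) (u w : n → ℂ) :
    HasDerivAt (fun t => u ⬝ᵥ (ρ t *ᵥ w)) (u ⬝ᵥ (ρ' *ᵥ w)) x := by
  simp only [dotProduct, Matrix.mulVec]
  exact HasDerivAt.fun_sum fun a _ =>
    (HasDerivAt.fun_sum fun b _ => (h a b).mul_const (w b)).const_mul (u a)

/-- Measuring in the eigenbasis of the symmetric logarithmic derivative attains the
quantum Fisher information: if `L` is a Hermitian SLD of the family at `φ₀`, `{v_j}` an
orthonormal eigenbasis of `L`, and `q_j(φ) = ⟨v_j|ρ_φ|v_j⟩` with `q_j(φ₀) > 0`, then the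
classical Fisher information `∑_j q̇_j(φ₀)² / q_j(φ₀)` equals `Tr[ρ_{φ₀} L²]`. -/
theorem sld_measurement_attains_qfi {d : ℕ}
    (ρ : ℝ → Matrix (Fin d) (Fin d) ℂ) (φ₀ : ℝ)
    (hdiff : ∀ a b, Differentiable ℝ (fun φ => ρ φ a b))
    (hdens : ∀ φ, (ρ φ).PosSemidef ∧ (ρ φ).trace = 1)
    (ρ' : Matrix (Fin d) (Fin d) ℂ)
    (hρ' : ∀ a b, HasDerivAt (fun φ => ρ φ a b) (ρ' a b) φ₀)
    (L : Matrix (Fin d) (Fin d) ℂ) (hL : L.IsHermitian)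
    (hSLD : ρ' = (1 / 2 : ℂ) • (L * ρ φ₀ + ρ φ₀ * L))
    (v : Fin d → Fin d → ℂ) (lam : Fin d → ℝ)
    (hON : ∀ j k, (∑ a, star (v j a) * v k a) = if j = k then 1 else 0)
    (heig : ∀ j, L *ᵥ v j = (lam j : ℂ) • v j)
    (Q : Fin d → ℝ → ℝ)
    (hQ : ∀ j φ, (Q j φ : ℂ) = star (v j) ⬝ᵥ ((ρ φ) *ᵥ v j))
    (Q' : Fin d → ℝ)
    (hQ' : ∀ j, HasDerivAt (fun φ => Q j φ) (Q' j) φ₀)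
    (hpos : ∀ j, 0 < Q j φ₀) :
    ((∑ j, (Q' j) ^ 2 / Q j φ₀ : ℝ) : ℂ) = (ρ φ₀ * (L * L)).trace := by
  have hderiv (j : Fin d) : Q' j = lam j * Q j φ₀ := by
    have h₁ := (hQ' j).ofReal_comp
    simp only [hQ j] at h₁
    have h₂ := h₁.unique (HasDerivAt.dotProduct_mulVec_of_entries hρ' (star (v j)) (v j))
    rw [hSLD, Matrix.smul_mulVec, Matrix.add_mulVec, ← Matrix.mulVec_mulVec,
      ← Matrix.mulVec_mulVec, heig, Matrix.mulVec_smul, dotProduct_smul, dotProduct_add,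
      hL.star_dotProduct_mulVec_eigenvector (heig j), dotProduct_smul, ← hQ j φ₀] at h₂
    simp only [smul_eq_mul] at h₂
    apply Complex.ofReal_injective
    rw [h₂]
    push_cast
    ring
  rw [Matrix.trace_eq_sum_star_dotProduct_mulVec v hON, Complex.ofReal_sum]
  refine Finset.sum_congr rfl fun j _ => ?_
  have hq : (Q j φ₀ : ℂ) ≠ 0 := Complex.ofReal_ne_zero.mpr (hpos j).ne'
  simp only [← Matrix.mulVec_mulVec, heig, Matrix.mulVec_smul, dotProduct_smul, ← hQ j φ₀,
    smul_eq_mul, hderiv j]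
  push_cast
  field_simp
end

section
/- Let H₁,…,H_{2N} and memory spaces A₁,…,A_{N−1} be finite-dimensional complex Hilbert spaces, and for k = 1,…,N let ℰ_k be a completely positive trace-preserving map from L(H_{2k−1}⊗A_{k−1}) to L(H_{2k}⊗A_k) (with A₀ and A_N one-dimensional), with Choi operator E_k. Then the operator C := E₁ * E₂ * ⋯ * E_N ∈ L(H₁⊗⋯⊗H_{2N}) obtained by link products over the memory spaces satisfies the quantum comb conditions: C ≥ 0 and _{2N,…,2i,2i−1}C = _{2N,…,2i}C for every i = 1,…,N. -/
open Matrix BigOperators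
open scoped ComplexOrder

/-- The index type of `H₁ ⊗ H₂ ⊗ ⋯ ⊗ H_{2N}`, grouping the `2N` spaces into the `N`
input–output pairs `(H_{2k−1}, H_{2k})`, with `p k = dim H_{2k−1}` and
`q k = dim H_{2k}`. -/
abbrev CombIdx {N : ℕ} (p q : Fin N → ℕ) : Type :=
  (k : Fin N) → Fin (p k) × Fin (q k)

/-- The normalized reinsertion-trace `_S C = (I_S / d_S) ⊗ Tr_S C` where the traced
set `S` consists of the input factors `H_{2k−1}` with `tin k = true` and the output
factors `H_{2k}` with `tout k = true`. -/
noncomputable def nred {N : ℕ} {p q : Fin N → ℕ} (tin tout : Fin N → Bool)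
    (C : Matrix (CombIdx p q) (CombIdx p q) ℂ) :
    Matrix (CombIdx p q) (CombIdx p q) ℂ :=
  Matrix.of fun u v =>
    (if (∀ k, (tin k = true → (u k).1 = (v k).1) ∧ (tout k = true → (u k).2 = (v k).2))
      then (1 : ℂ) else 0)
    * ((∏ k, ((if tin k = true then p k else 1) * (if tout k = true then q k else 1)) : ℕ) : ℂ)⁻¹
    * ∑ w : CombIdx p q,
        (if (∀ k, (tin k = false → (w k).1 = (u k).1) ∧ (tout k = false → (w k).2 = (u k).2))
          then (1 : ℂ) else 0)
        * C w (fun k => (if tin k = true then (w k).1 else (v k).1,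
                         if tout k = true then (w k).2 else (v k).2))

/-- The quantum comb conditions `_{2N,…,2i,2i−1} C = _{2N,…,2i} C` for `i = 1,…,N`:
for each pair index `i`, tracing (with normalized reinsertion) all inputs and outputs
from step `i` on equals doing so for all outputs from step `i` on and all inputs
strictly after step `i`. -/
noncomputable def CombCond {N : ℕ} {p q : Fin N → ℕ}
    (C : Matrix (CombIdx p q) (CombIdx p q) ℂ) : Prop :=
  ∀ i : Fin N,
    nred (fun k => decide (i ≤ k)) (fun k => decide (i ≤ k)) C =
      nred (fun k => decide (i < k)) (fun k => decide (i ≤ k)) C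

/-- The iterated link product `E₁ * E₂ * ⋯ * E_N` over the memory spaces
`A₁,…,A_{N−1}` (with `m k = dim A_k`, `A₀ = A_N = ℂ`), where `E k` is the Choi operator
of a map from `L(H_{2k−1} ⊗ A_{k−1})` to `L(H_{2k} ⊗ A_k)`. -/
noncomputable def chainLink {N : ℕ} {p q : Fin N → ℕ} {m : Fin (N + 1) → ℕ}
    (E : (k : Fin N) →
      Matrix ((Fin (p k) × Fin (m k.castSucc)) × (Fin (q k) × Fin (m k.succ)))
             ((Fin (p k) × Fin (m k.castSucc)) × (Fin (q k) × Fin (m k.succ))) ℂ) :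
    Matrix (CombIdx p q) (CombIdx p q) ℂ :=
  Matrix.of fun u v =>
    ∑ a : (k : Fin (N + 1)) → Fin (m k), ∑ b : (k : Fin (N + 1)) → Fin (m k),
      ∏ k : Fin N,
        E k (((u k).1, a k.castSucc), ((u k).2, a k.succ))
            (((v k).1, b k.castSucc), ((v k).2, b k.succ))

/-- A chain of link products of positive semidefinite operators is positive semidefinite. -/
theorem chainLink_posSemidef {N : ℕ} {p q : Fin N → ℕ} {m : Fin (N + 1) → ℕ}
    (E : (k : Fin N) →
      Matrix ((Fin (p k) × Fin (m k.castSucc)) × (Fin (q k) × Fin (m k.succ)))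
             ((Fin (p k) × Fin (m k.castSucc)) × (Fin (q k) × Fin (m k.succ))) ℂ)
    (hpos : ∀ k, (E k).PosSemidef) : (chainLink E).PosSemidef := by
  have hfac : ∀ k, ∃ B : Matrix ((Fin (p k) × Fin (m k.castSucc)) × (Fin (q k) × Fin (m k.succ)))
      ((Fin (p k) × Fin (m k.castSucc)) × (Fin (q k) × Fin (m k.succ))) ℂ, E k = Bᴴ * B :=
    fun k => by
      classical
      open scoped MatrixOrder in
      exact CStarAlgebra.nonneg_iff_eq_star_mul_self.mp (hpos k).nonneg
  choose B hB using hfac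
  let F : Matrix ((k : Fin N) → (Fin (p k) × Fin (m k.castSucc)) × (Fin (q k) × Fin (m k.succ)))
      (CombIdx p q) ℂ := Matrix.of fun c u =>
    ∑ a : (k : Fin (N + 1)) → Fin (m k),
      ∏ k, B k (c k) (((u k).1, a k.castSucc), ((u k).2, a k.succ))
  have hF : chainLink E = Fᴴ * F := by
    ext u v
    simp only [chainLink, Matrix.of_apply, hB, Matrix.mul_apply, Matrix.conjTranspose_apply, F,
      star_sum, star_prod, Finset.sum_mul_sum, Finset.prod_univ_sum, Fintype.piFinset_univ,
      Finset.prod_mul_distrib]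
    rw [Finset.sum_comm]
    refine (Finset.sum_congr rfl fun b _ => Finset.sum_comm).trans ?_
    rw [Finset.sum_comm]
    exact Finset.sum_congr rfl fun c _ => Finset.sum_comm
  rw [hF]
  exact Matrix.posSemidef_conjTranspose_mul_self F

/-- The first operator of a chain. -/
def chainHead {N : ℕ} {p q : Fin (N + 1) → ℕ} {m : Fin (N + 2) → ℕ}
    (E : (k : Fin (N + 1)) →
      Matrix ((Fin (p k) × Fin (m k.castSucc)) × (Fin (q k) × Fin (m k.succ)))
             ((Fin (p k) × Fin (m k.castSucc)) × (Fin (q k) × Fin (m k.succ))) ℂ) :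
    Matrix ((Fin (p 0) × Fin (m 0)) × (Fin (q 0) × Fin (m 1)))
      ((Fin (p 0) × Fin (m 0)) × (Fin (q 0) × Fin (m 1))) ℂ :=
  E 0

/-- The chain of link products with the initial memory indices held fixed and the final memory
traced out. -/
noncomputable def chainFrom : {N : ℕ} → {p q : Fin N → ℕ} → {m : Fin (N + 1) → ℕ} →
    ((k : Fin N) →
      Matrix ((Fin (p k) × Fin (m k.castSucc)) × (Fin (q k) × Fin (m k.succ)))
             ((Fin (p k) × Fin (m k.castSucc)) × (Fin (q k) × Fin (m k.succ))) ℂ) →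
    Fin (m 0) → Fin (m 0) → Matrix (CombIdx p q) (CombIdx p q) ℂ
  | 0, _, _, _, _, a, b => fun _ _ => if a = b then 1 else 0
  | N + 1, p, q, m, E, a, b => fun u v =>
    ∑ a' : Fin (m 1), ∑ b' : Fin (m 1),
      chainHead E (((u 0).1, a), ((u 0).2, a')) (((v 0).1, b), ((v 0).2, b'))
        * chainFrom (N := N) (p := fun k => p k.succ) (q := fun k => q k.succ)
            (m := fun k => m k.succ) (fun k => E k.succ) a' b'
            (fun k => u k.succ) (fun k => v k.succ)

theorem sum_fin_cons {N : ℕ} {α : Fin (N + 1) → Type*} [∀ k, Fintype (α k)]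
    {M : Type*} [AddCommMonoid M] (f : ((k : Fin (N + 1)) → α k) → M) :
    ∑ a, f a = ∑ x : α 0, ∑ a : (k : Fin N) → α k.succ, f (Fin.cons x a) := by
  rw [← (Fin.consEquiv α).sum_comp, Fintype.sum_prod_type]
  rfl

theorem sum_chain_eq_sum_chainFrom {N : ℕ} {p q : Fin N → ℕ} {m : Fin (N + 1) → ℕ}
    (E : (k : Fin N) →
      Matrix ((Fin (p k) × Fin (m k.castSucc)) × (Fin (q k) × Fin (m k.succ)))
             ((Fin (p k) × Fin (m k.castSucc)) × (Fin (q k) × Fin (m k.succ))) ℂ)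
    (u v : CombIdx p q) (x y : Fin (m 0)) :
    (∑ a : (k : Fin N) → Fin (m k.succ), ∑ b : (k : Fin N) → Fin (m k.succ),
      (if (Fin.cons x a : (k : Fin (N + 1)) → Fin (m k)) (Fin.last N)
          = (Fin.cons y b : (k : Fin (N + 1)) → Fin (m k)) (Fin.last N) then (1 : ℂ) else 0) *
      ∏ k : Fin N,
        E k (((u k).1, (Fin.cons x a : (k : Fin (N + 1)) → Fin (m k)) k.castSucc), ((u k).2, a k))
            (((v k).1, (Fin.cons y b : (k : Fin (N + 1)) → Fin (m k)) k.castSucc), ((v k).2, b k)))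
      = chainFrom E x y u v := by
  induction N with
  | zero => simp [chainFrom, Fin.last]
  | succ N ih =>
    simp only [chainFrom]
    rw [sum_fin_cons]
    refine Finset.sum_congr rfl fun a' _ => ?_
    simp_rw [sum_fin_cons (N := N)]
    rw [Finset.sum_comm]
    refine Finset.sum_congr rfl fun b' _ => ?_
    rw [← ih (p := fun k => p k.succ) (q := fun k => q k.succ) (m := fun k => m k.succ)
      (fun k => E k.succ)]
    simp only [Finset.mul_sum]
    refine Finset.sum_congr rfl fun a _ => Finset.sum_congr rfl fun b _ => ?_
    rw [Fin.prod_univ_succ, mul_left_comm]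
    rfl

theorem chainLink_eq_chainFrom {N : ℕ} {p q : Fin N → ℕ} {m : Fin (N + 1) → ℕ}
    (hm0 : m 0 = 1) (hmN : m (Fin.last N) = 1)
    (E : (k : Fin N) →
      Matrix ((Fin (p k) × Fin (m k.castSucc)) × (Fin (q k) × Fin (m k.succ)))
             ((Fin (p k) × Fin (m k.castSucc)) × (Fin (q k) × Fin (m k.succ))) ℂ) :
    ∃ x : Fin (m 0), chainLink E = chainFrom E x x := by
  have hs0 : Subsingleton (Fin (m 0)) := by rw [hm0]; infer_instance
  have hsN : Subsingleton (Fin (m (Fin.last N))) := by rw [hmN]; infer_instance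
  let x : Fin (m 0) := ⟨0, by omega⟩
  refine ⟨x, ?_⟩
  ext u v
  rw [← sum_chain_eq_sum_chainFrom]
  simp only [chainLink, Matrix.of_apply]
  simp_rw [sum_fin_cons (N := N)]
  rw [Fintype.sum_subsingleton _ x]
  refine Finset.sum_congr rfl fun a _ => ?_
  rw [Fintype.sum_subsingleton _ x]
  refine Finset.sum_congr rfl fun b _ => ?_
  rw [if_pos (Subsingleton.elim _ _), one_mul]
  rfl

/-- The unnormalized partial trace entering `nred`. -/
noncomputable def traceSum {N : ℕ} {p q : Fin N → ℕ} (tin tout : Fin N → Bool)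
    (C : Matrix (CombIdx p q) (CombIdx p q) ℂ) (u v : CombIdx p q) : ℂ :=
  ∑ w : CombIdx p q,
    (if (∀ k, (tin k = false → (w k).1 = (u k).1) ∧ (tout k = false → (w k).2 = (u k).2))
      then (1 : ℂ) else 0)
    * C w (fun k => (if tin k = true then (w k).1 else (v k).1,
                     if tout k = true then (w k).2 else (v k).2))

theorem nred_apply {N : ℕ} {p q : Fin N → ℕ} (tin tout : Fin N → Bool)
    (C : Matrix (CombIdx p q) (CombIdx p q) ℂ) (u v : CombIdx p q) :
    nred tin tout C u v =
      (if (∀ k, (tin k = true → (u k).1 = (v k).1) ∧ (tout k = true → (u k).2 = (v k).2))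
        then (1 : ℂ) else 0)
      * ((∏ k, ((if tin k = true then p k else 1) * (if tout k = true then q k else 1)) : ℕ) : ℂ)⁻¹
      * traceSum tin tout C u v :=
  rfl

theorem traceSum_chainFrom_succ {N : ℕ} {p q : Fin (N + 1) → ℕ} {m : Fin (N + 2) → ℕ}
    (E : (k : Fin (N + 1)) →
      Matrix ((Fin (p k) × Fin (m k.castSucc)) × (Fin (q k) × Fin (m k.succ)))
             ((Fin (p k) × Fin (m k.castSucc)) × (Fin (q k) × Fin (m k.succ))) ℂ)
    (tin tout : Fin (N + 1) → Bool) (a b : Fin (m 0)) (u v : CombIdx p q)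
    {T : Fin (m 1) → Fin (m 1) → ℂ}
    (hT : ∀ a' b', traceSum (p := fun k => p k.succ) (q := fun k => q k.succ)
      (fun k => tin k.succ) (fun k => tout k.succ)
      (chainFrom (N := N) (p := fun k => p k.succ) (q := fun k => q k.succ)
        (m := fun k => m k.succ) (fun k => E k.succ) a' b')
      (fun k => u k.succ) (fun k => v k.succ) = T a' b') :
    traceSum tin tout (chainFrom E a b) u v =
      ∑ w : Fin (p 0) × Fin (q 0),
        (if (tin 0 = false → w.1 = (u 0).1) ∧ (tout 0 = false → w.2 = (u 0).2)
          then (1 : ℂ) else 0) *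
        ∑ a' : Fin (m 1), ∑ b' : Fin (m 1),
          chainHead E ((w.1, a), (w.2, a'))
              ((if tin 0 = true then w.1 else (v 0).1, b),
                (if tout 0 = true then w.2 else (v 0).2, b')) * T a' b' := by
  obtain rfl : _ = T := funext₂ hT
  rw [traceSum, sum_fin_cons]
  refine Finset.sum_congr rfl fun w _ => ?_
  simp only [traceSum, chainFrom, Finset.mul_sum]
  rw [Finset.sum_comm]
  refine Finset.sum_congr rfl fun a' _ => ?_
  rw [Finset.sum_comm]
  refine Finset.sum_congr rfl fun b' _ => ?_
  refine Finset.sum_congr rfl fun w' _ => ?_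
  simp only [Fin.forall_fin_succ, Fin.cons_zero, Fin.cons_succ]
  rw [ite_and]
  split_ifs <;> simp

theorem traceSum_all_chainFrom {N : ℕ} {p q : Fin N → ℕ} {m : Fin (N + 1) → ℕ}
    (E : (k : Fin N) →
      Matrix ((Fin (p k) × Fin (m k.castSucc)) × (Fin (q k) × Fin (m k.succ)))
             ((Fin (p k) × Fin (m k.castSucc)) × (Fin (q k) × Fin (m k.succ))) ℂ)
    (hTP : ∀ k, ∀ (x x' : Fin (p k)) (a a' : Fin (m k.castSucc)),
      (∑ y : Fin (q k), ∑ b : Fin (m k.succ), E k ((x, a), (y, b)) ((x', a'), (y, b)))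
        = if x = x' ∧ a = a' then 1 else 0)
    (a b : Fin (m 0)) (u v : CombIdx p q) :
    traceSum (fun _ => true) (fun _ => true) (chainFrom E a b) u v =
      if a = b then ∏ k, (p k : ℂ) else 0 := by
  induction N with
  | zero => simp [traceSum, chainFrom]
  | succ N ih =>
    rw [traceSum_chainFrom_succ E _ _ a b u v
      (T := fun a' b' => if a' = b' then ∏ k : Fin N, (p k.succ : ℂ) else 0)
      fun a' b' => ih (p := fun k => p k.succ)
      (q := fun k => q k.succ) (m := fun k => m k.succ) (fun k => E k.succ)
      (fun k => hTP k.succ) a' b' _ _]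
    have h : ∀ (x x' : Fin (p 0)) (a a' : Fin (m 0)),
        (∑ y, ∑ c, chainHead E ((x, a), (y, c)) ((x', a'), (y, c)))
          = if x = x' ∧ a = a' then 1 else 0 := hTP 0
    simp only [Bool.true_eq_false, false_imp_iff, and_self, if_true, one_mul, mul_ite, mul_zero,
      Finset.sum_ite_eq, Finset.mem_univ, Fintype.sum_prod_type, ← Finset.sum_mul]
    rw [Finset.sum_congr rfl fun x _ => h x x a b]
    rw [Fin.prod_univ_succ]
    by_cases hab : a = b <;> simp [hab]

/-- Before normalization, tracing out the `i`-th input in addition to everything after it has the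
same effect as closing the `i`-th input with the identity. -/
theorem traceSum_chainFrom_comb {N : ℕ} {p q : Fin N → ℕ} {m : Fin (N + 1) → ℕ}
    (E : (k : Fin N) →
      Matrix ((Fin (p k) × Fin (m k.castSucc)) × (Fin (q k) × Fin (m k.succ)))
             ((Fin (p k) × Fin (m k.castSucc)) × (Fin (q k) × Fin (m k.succ))) ℂ)
    (hTP : ∀ k, ∀ (x x' : Fin (p k)) (a a' : Fin (m k.castSucc)),
      (∑ y : Fin (q k), ∑ b : Fin (m k.succ), E k ((x, a), (y, b)) ((x', a'), (y, b)))
        = if x = x' ∧ a = a' then 1 else 0)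
    (i : Fin N) (a b : Fin (m 0)) (u v : CombIdx p q) :
    (p i : ℂ) *
        traceSum (fun k => decide (i < k)) (fun k => decide (i ≤ k)) (chainFrom E a b) u v =
      if (u i).1 = (v i).1 then
        traceSum (fun k => decide (i ≤ k)) (fun k => decide (i ≤ k)) (chainFrom E a b) u v
      else 0 := by
  induction N with
  | zero => exact i.elim0
  | succ N ih =>
    cases i using Fin.cases with
    | zero =>
      have hall : (fun k : Fin (N + 1) => decide (0 ≤ k)) = fun _ => true := by simp
      have htail : (fun k : Fin N => decide (0 < k.succ)) = fun _ => true := by simp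
      rw [hall, traceSum_all_chainFrom E hTP,
        traceSum_chainFrom_succ E _ _ a b u v
          (T := fun a' b' => if a' = b' then ∏ k : Fin N, (p k.succ : ℂ) else 0)
          fun a' b' => by
            rw [htail]
            exact traceSum_all_chainFrom (p := fun k => p k.succ) (q := fun k => q k.succ)
              (m := fun k => m k.succ) (fun k => E k.succ) (fun k => hTP k.succ) a' b' _ _]
      have h : ∀ (x x' : Fin (p 0)) (a a' : Fin (m 0)),
          (∑ y, ∑ c, chainHead E ((x, a), (y, c)) ((x', a'), (y, c)))
            = if x = x' ∧ a = a' then 1 else 0 := hTP 0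
      simp only [lt_self_iff_false, decide_false, Bool.true_eq_false, Bool.false_eq_true,
        false_imp_iff, and_true, forall_const, if_true, if_false, mul_ite, mul_zero, ite_mul,
        one_mul, zero_mul, Finset.sum_ite_eq, Finset.mem_univ, Fintype.sum_prod_type, ← Finset.sum_mul]
      rw [Finset.sum_comm]
      simp only [Finset.sum_ite_eq', Finset.mem_univ, if_true, ← Finset.sum_mul]
      rw [h, Fin.prod_univ_succ]
      by_cases hab : a = b <;> by_cases huv : (u 0).1 = (v 0).1 <;> simp [hab, huv]
    | succ i =>
      let T (tin tout : Fin N → Bool) (a' b' : Fin (m 1)) : ℂ :=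
        traceSum (p := fun k => p k.succ) (q := fun k => q k.succ) tin tout
          (chainFrom (p := fun k => p k.succ) (q := fun k => q k.succ)
            (m := fun k => m k.succ) (fun k => E k.succ) a' b')
          (fun k => u k.succ) (fun k => v k.succ)
      have hT : ∀ a' b', (p i.succ : ℂ) *
            T (fun k => decide (i.succ < k.succ)) (fun k => decide (i.succ ≤ k.succ)) a' b' =
          if (u i.succ).1 = (v i.succ).1 then
            T (fun k => decide (i.succ ≤ k.succ)) (fun k => decide (i.succ ≤ k.succ)) a' b'
          else 0 := fun a' b' => by
        simp only [Fin.succ_lt_succ_iff, Fin.succ_le_succ_iff]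
        exact ih (p := fun k => p k.succ) (q := fun k => q k.succ)
          (m := fun k => m k.succ) (fun k => E k.succ) (fun k => hTP k.succ) i a' b'
          (fun k => u k.succ) (fun k => v k.succ)
      rw [traceSum_chainFrom_succ E _ _ a b u v (T := T _ _) fun _ _ => rfl,
        traceSum_chainFrom_succ E _ _ a b u v (T := T _ _) fun _ _ => rfl]
      simp only [Finset.mul_sum, mul_left_comm (p i.succ : ℂ), hT, Fin.not_lt_zero,
        Fin.le_zero_iff, Fin.succ_ne_zero, decide_false]
      by_cases huv : (u i.succ).1 = (v i.succ).1
      · simp only [huv, if_true]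
      · simp only [huv, if_false, mul_zero, Finset.sum_const_zero]

/-- The Choi operator of the concatenation (over inaccessible memory spaces) of `N`
CPTP maps `ℰ_k : L(H_{2k−1} ⊗ A_{k−1}) → L(H_{2k} ⊗ A_k)` (with `A₀`, `A_N`
one-dimensional) is positive semidefinite and satisfies the quantum comb conditions. -/
theorem chainLink_isComb {N : ℕ} {p q : Fin N → ℕ} {m : Fin (N + 1) → ℕ}
    (hm0 : m 0 = 1) (hmN : m (Fin.last N) = 1)
    (E : (k : Fin N) →
      Matrix ((Fin (p k) × Fin (m k.castSucc)) × (Fin (q k) × Fin (m k.succ)))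
             ((Fin (p k) × Fin (m k.castSucc)) × (Fin (q k) × Fin (m k.succ))) ℂ)
    (hpos : ∀ k, (E k).PosSemidef)
    (hTP : ∀ k, ∀ (x x' : Fin (p k)) (a a' : Fin (m k.castSucc)),
      (∑ y : Fin (q k), ∑ b : Fin (m k.succ), E k ((x, a), (y, b)) ((x', a'), (y, b)))
        = if x = x' ∧ a = a' then 1 else 0) :
    (chainLink E).PosSemidef ∧ CombCond (chainLink E) := by
  refine ⟨chainLink_posSemidef E hpos, fun i => ?_⟩
  obtain ⟨x, hx⟩ := chainLink_eq_chainFrom hm0 hmN E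
  ext u v
  have hcomb := traceSum_chainFrom_comb E hTP i x x u v
  rw [← hx] at hcomb
  have hp : (p i : ℂ) ≠ 0 := Nat.cast_ne_zero.mpr (Fin.pos (u i).1).ne'
  have hdim : (∏ k, ((if decide (i ≤ k) = true then p k else 1) *
        (if decide (i ≤ k) = true then q k else 1))) =
      p i * ∏ k, ((if decide (i < k) = true then p k else 1) *
        (if decide (i ≤ k) = true then q k else 1)) := by
    rw [← Finset.mul_prod_erase _ _ (Finset.mem_univ i),
      ← Finset.mul_prod_erase (f := fun k => (if decide (i < k) = true then p k else 1) *
        (if decide (i ≤ k) = true then q k else 1)) _ (Finset.mem_univ i)]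
    simp only [le_refl, lt_self_iff_false, decide_true, decide_false, if_true, Bool.false_eq_true,
      if_false, one_mul, mul_assoc]
    congr 2
    refine Finset.prod_congr rfl fun k hk => ?_
    have hlt : i ≤ k ↔ i < k := (Ne.symm (Finset.ne_of_mem_erase hk)).le_iff_lt
    simp only [hlt]
  have hind : (∀ k, (decide (i ≤ k) = true → (u k).1 = (v k).1) ∧
        (decide (i ≤ k) = true → (u k).2 = (v k).2)) ↔
      (u i).1 = (v i).1 ∧ ∀ k, (decide (i < k) = true → (u k).1 = (v k).1) ∧
        (decide (i ≤ k) = true → (u k).2 = (v k).2) := by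
    simp only [decide_eq_true_eq, le_iff_lt_or_eq]
    grind
  rw [nred_apply, nred_apply, hdim, Nat.cast_mul, mul_inv]
  simp only [hind]
  have hcomb' : traceSum (fun k => decide (i < k)) (fun k => decide (i ≤ k)) (chainLink E) u v =
      (p i : ℂ)⁻¹ * if (u i).1 = (v i).1 then
        traceSum (fun k => decide (i ≤ k)) (fun k => decide (i ≤ k)) (chainLink E) u v
      else 0 := by
    rw [← hcomb, inv_mul_cancel_left₀ hp]
  rw [hcomb', ite_and]
  split_ifs <;> ring
end

section
/- Let φ ↦ 𝐂_φ = (|C_{φ,1}⟩,…,|C_{φ,r}⟩) be a continuously differentiable family of D×r complex matrices, set C_φ := 𝐂_φ𝐂_φ†, and let P = |P⟩⟨P| be a rank-one positive semidefinite operator on ℂ^D ⊗ H_F such that the output family ρ_φ := ∑_{i=1}^r (⟨C̄_{φ,i}|⊗I_F)P(|C̄_{φ,i}⟩⊗I_F) is a family of density matrices on H_F of constant rank. Then the purification-based quantum Fisher information of ρ_φ at φ₀ satisfies J(ρ_φ) = min_{h Hermitian r×r} Tr[(Tr_F P) Ω_{φ₀}(h)], where Ω_φ(h) := 4((𝐂̇_φ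 − i𝐂_φh)(𝐂̇_φ − i𝐂_φh)†)^T is the performance operator. -/
open Matrix BigOperators
open scoped ComplexOrder

/-- The performance operator `Ω_φ(h) = 4((Cfaṁ_φ − iCfam_φh)(Cfaṁ_φ − iCfam_φh)†)ᵀ`. -/
noncomputable def perfOp {D r : ℕ} (Cmat Cdot : Matrix (Fin D) (Fin r) ℂ)
    (h : Matrix (Fin r) (Fin r) ℂ) : Matrix (Fin D) (Fin D) ℂ :=
  (4 : ℂ) • (((Cdot - Complex.I • (Cmat * h)) * (Cdot - Complex.I • (Cmat * h))ᴴ)ᵀ)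

/-- Partial trace over the global future factor `H_F` of an operator on `ℂ^D ⊗ H_F`. -/
noncomputable def ptraceF {D dF : ℕ}
    (P : Matrix (Fin D × Fin dF) (Fin D × Fin dF) ℂ) : Matrix (Fin D) (Fin D) ℂ :=
  Matrix.of fun a b => ∑ x : Fin dF, P (a, x) (b, x)

namespace Matrix

variable {m n p : Type*} [Fintype m] [Fintype n] [Fintype p]

/-- Trace form of the Frobenius norm. -/
theorem re_trace_mul_conjTranspose_self (M : Matrix m n ℂ) :
    (M * Mᴴ).trace.re = ∑ i, ∑ j, ‖M i j‖ ^ 2 := by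
  simp only [trace, diag_apply, mul_apply, conjTranspose_apply, Complex.re_sum]
  refine Finset.sum_congr rfl fun i _ => Finset.sum_congr rfl fun j _ => ?_
  rw [Complex.star_def, Complex.mul_conj, Complex.ofReal_re, Complex.normSq_eq_norm_sq]

/-- Every matrix over a field has a generalized inverse. -/
theorem exists_mul_mul_self_eq {K : Type*} [Field K] [DecidableEq m] [DecidableEq n]
    (A : Matrix m n K) :
    ∃ G : Matrix n m K, A * G * A = A := by
  obtain ⟨g, hg⟩ := A.toLin'.rangeRestrict.exists_rightInverse_of_surjective
    A.toLin'.range_rangeRestrict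
  obtain ⟨f, hf⟩ := g.exists_extend
  refine ⟨LinearMap.toMatrix' f, ?_⟩
  apply Matrix.toLin'.injective
  rw [Matrix.toLin'_mul, Matrix.toLin'_mul, Matrix.toLin'_toMatrix']
  ext1 i
  ext1
  have h1 := LinearMap.congr_fun hf (A.toLin'.rangeRestrict (LinearMap.single K (fun _ => K) i 1))
  have h2 := LinearMap.congr_fun hg (A.toLin'.rangeRestrict (LinearMap.single K (fun _ => K) i 1))
  simp only [LinearMap.comp_apply] at h1 h2 ⊢
  have h3 : f (A.toLin' (LinearMap.single K (fun _ => K) i 1)) =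
      g (A.toLin'.rangeRestrict (LinearMap.single K (fun _ => K) i 1)) := h1
  rw [h3]
  exact congrArg Subtype.val h2

/-- If `Aᴴ * X` is Hermitian and `ker A ≤ ker X`, then `X` factors through `A` by a
Hermitian matrix. -/
theorem exists_isHermitian_mul_eq (A X : Matrix m n ℂ) (hAX : (Aᴴ * X).IsHermitian)
    (hker : ∀ v, A *ᵥ v = 0 → X *ᵥ v = 0) :
    ∃ L : Matrix m m ℂ, L.IsHermitian ∧ L * A = X := by
  classical
  obtain ⟨G, hG⟩ := A.exists_mul_mul_self_eq
  have hX : X * G * A = X := by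
    apply Matrix.toLin'.injective
    refine LinearMap.ext fun v => ?_
    have h1 : X *ᵥ (v - G *ᵥ (A *ᵥ v)) = 0 := by
      apply hker
      rw [mulVec_sub, mulVec_mulVec, mulVec_mulVec, hG, sub_self]
    rw [mulVec_sub, sub_eq_zero] at h1
    rw [toLin'_apply, toLin'_apply, h1, mulVec_mulVec, mulVec_mulVec, Matrix.mul_assoc]
  have hH : Xᴴ * A = Aᴴ * X := by
    have := hAX.eq
    rwa [conjTranspose_mul, conjTranspose_conjTranspose] at this
  refine ⟨X * G + Gᴴ * Xᴴ - Gᴴ * (Aᴴ * X) * G, ?_, ?_⟩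
  · unfold IsHermitian
    simp only [conjTranspose_add, conjTranspose_sub, conjTranspose_mul,
      conjTranspose_conjTranspose, hH, ← Matrix.mul_assoc]
    simp only [Matrix.mul_assoc]
    abel
  · rw [Matrix.sub_mul, Matrix.add_mul, hX, Matrix.mul_assoc Gᴴ Xᴴ A, hH,
      show Gᴴ * (Aᴴ * X) * G * A = Gᴴ * (Aᴴ * (X * G * A)) by simp only [Matrix.mul_assoc], hX]
    abel

/-- Symmetric-logarithmic-derivative lower bound. -/
theorem re_trace_le_of_isHermitian (L : Matrix m m ℂ) (hL : L.IsHermitian)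
    (A : Matrix m n ℂ) (B B' : Matrix m p ℂ) (hAB : B * Bᴴ = A * Aᴴ)
    (hd : L * A * Aᴴ + A * (L * A)ᴴ = B' * Bᴴ + B * B'ᴴ) :
    (L * A * (L * A)ᴴ).trace.re ≤ (B' * B'ᴴ).trace.re := by
  have h0 : 0 ≤ ((B' - L * B) * (B' - L * B)ᴴ).trace.re := by
    rw [re_trace_mul_conjTranspose_self]; positivity
  have e : ((B' - L * B) * (B' - L * B)ᴴ).trace =
      (B' * B'ᴴ).trace - (L * A * (L * A)ᴴ).trace := by
    have h1 : (L * B * B'ᴴ).trace + (B' * (L * B)ᴴ).trace =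
        2 * (L * A * (L * A)ᴴ).trace := by
      have : (L * (L * A * Aᴴ + A * (L * A)ᴴ)).trace = (L * (B' * Bᴴ + B * B'ᴴ)).trace := by
        rw [hd]
      rw [Matrix.mul_add, Matrix.mul_add, trace_add, trace_add, conjTranspose_mul, hL.eq] at this
      rw [conjTranspose_mul, conjTranspose_mul, hL.eq,
        ← Matrix.mul_assoc B', trace_mul_comm (B' * Bᴴ) L, Matrix.mul_assoc L B, add_comm, ← this]
      have h2 : (L * (L * A * Aᴴ)).trace = (L * A * (Aᴴ * L)).trace := by
        rw [trace_mul_comm]; simp only [Matrix.mul_assoc]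
      rw [h2, two_mul]
      simp only [Matrix.mul_assoc]
    have h3 : (L * B * (L * B)ᴴ) = L * A * (L * A)ᴴ := by
      rw [conjTranspose_mul, conjTranspose_mul,
        show L * B * (Bᴴ * Lᴴ) = L * (B * Bᴴ) * Lᴴ by simp only [Matrix.mul_assoc], hAB]
      simp only [Matrix.mul_assoc]
    rw [conjTranspose_sub, Matrix.sub_mul, Matrix.mul_sub, Matrix.mul_sub, trace_sub, trace_sub,
      trace_sub, h3]
    linear_combination -h1
  rw [e, Complex.sub_re] at h0
  linarith

/-- The normal equation for minimizing the Frobenius norm of `A' - i A h` over Hermitian `h`. -/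
theorem exists_isHermitian_normal_equation (A A' : Matrix m n ℂ) :
    ∃ h : Matrix n n ℂ, h.IsHermitian ∧ (Aᴴ * (A' - Complex.I • (A * h))).IsHermitian := by
  classical
  let T : selfAdjoint.submodule ℝ (Matrix n n ℂ) →ₗ[ℝ] EuclideanSpace ℂ (m × n) :=
    { toFun := fun h => WithLp.toLp 2 fun x => (Complex.I • (A * h.1)) x.1 x.2
      map_add' := fun a b => by
        ext x; simp [Matrix.mul_add, mul_add]
      map_smul' := fun c a => by
        ext x; simp; ring }
  let a' : EuclideanSpace ℂ (m × n) := WithLp.toLp 2 fun x => A' x.1 x.2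
  obtain ⟨h, hh⟩ : (LinearMap.range T).starProjection a' ∈ LinearMap.range T := by simp
  refine ⟨h.1, h.2, ?_⟩
  set X := A' - Complex.I • (A * h.1) with hX
  have key : ∀ k : Matrix n n ℂ, k.IsHermitian → (Xᴴ * (Complex.I • (A * k))).trace.re = 0 := by
    intro k hk
    have hk' : k ∈ selfAdjoint.submodule ℝ (Matrix n n ℂ) := hk
    have h1 := (LinearMap.range T).starProjection_inner_eq_zero a' (T ⟨k, hk'⟩) ⟨_, rfl⟩
    rw [← hh] at h1
    rw [PiLp.inner_apply, Fintype.sum_prod_type_right] at h1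
    rw [← h1]
    simp only [trace, diag_apply, mul_apply, Complex.re_sum]
    refine Finset.sum_congr rfl fun i _ => Finset.sum_congr rfl fun j _ => ?_
    rw [Complex.inner, mul_comm]
    rw [hX]
    simp [T, a']
  set Z := Aᴴ * X with hZ
  have hk : (Complex.I • (Z - Zᴴ)).IsHermitian := by
    unfold IsHermitian
    rw [conjTranspose_smul, conjTranspose_sub, conjTranspose_conjTranspose, Complex.star_def,
      Complex.conj_I, neg_smul, ← smul_neg, neg_sub]
  have h1 := key _ hk
  have h2 : Xᴴ * (Complex.I • (A * (Complex.I • (Z - Zᴴ)))) = Zᴴ * (Zᴴ - Z) := by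
    rw [Matrix.mul_smul, Matrix.mul_smul, Matrix.mul_smul, smul_smul, Complex.I_mul_I, hZ,
      conjTranspose_mul, conjTranspose_conjTranspose, ← Matrix.mul_assoc, neg_one_smul,
      ← Matrix.mul_neg, neg_sub]
  rw [h2] at h1
  have h3 : ((Zᴴ - Z) * (Zᴴ - Z)ᴴ).trace.re = 0 := by
    have h4 : ((Zᴴ - Z) * (Zᴴ - Z)ᴴ).trace =
        (Zᴴ * (Zᴴ - Z)).trace * (-1) + star ((Zᴴ * (Zᴴ - Z)).trace) * (-1) := by
      rw [← trace_conjTranspose]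
      simp only [conjTranspose_mul, conjTranspose_sub, conjTranspose_conjTranspose,
        Matrix.sub_mul, Matrix.mul_sub, trace_sub]
      rw [trace_mul_comm Z Zᴴ]
      ring
    rw [h4]
    simp [h1]
  have h5 : Zᴴ - Z = 0 := by
    rw [re_trace_mul_conjTranspose_self] at h3
    ext i j
    have h6 := (Finset.sum_eq_zero_iff_of_nonneg (fun i _ => by positivity)).1 h3
      i (Finset.mem_univ _)
    have h7 := (Finset.sum_eq_zero_iff_of_nonneg (fun i _ => by positivity)).1 h6
      j (Finset.mem_univ _)
    simpa using h7
  exact sub_eq_zero.1 h5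

/-- If the rank of a family of matrices is maximal at `t₀`, its derivative at `t₀` maps the kernel
into the range. -/
theorem mulVec_deriv_mem_range_of_rank_le {A : ℝ → Matrix m n ℂ} {A' : Matrix m n ℂ} {t₀ : ℝ}
    (hA : ∀ i j, HasDerivAt (fun t => A t i j) (A' i j) t₀)
    (hrank : ∀ t, (A t).rank ≤ (A t₀).rank) {v : n → ℂ} (hv : A t₀ *ᵥ v = 0) :
    ∃ w, A t₀ *ᵥ w = A' *ᵥ v := by
  by_contra hcon
  let b := Module.finBasis ℂ (LinearMap.range (A t₀).mulVecLin)
  choose u hu using fun i => (b i).2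
  have hd : ∀ w, HasDerivAt (fun t => A t *ᵥ w) (A' *ᵥ w) t₀ := fun w => by
    rw [hasDerivAt_pi]
    intro i
    simp only [mulVec, dotProduct]
    exact HasDerivAt.fun_sum fun j _ => (hA i j).mul_const (w j)
  have hb : LinearIndependent ℂ (fun i => ((b i : LinearMap.range (A t₀).mulVecLin) : m → ℂ)) :=
    b.linearIndependent.map' (Submodule.subtype _) (Submodule.ker_subtype _)
  have hspan : A' *ᵥ v ∉ Submodule.span ℂ
      (Set.range fun i => ((b i : LinearMap.range (A t₀).mulVecLin) : m → ℂ)) := by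
    intro hmem
    have hle : Submodule.span ℂ
      (Set.range fun i => ((b i : LinearMap.range (A t₀).mulVecLin) : m → ℂ)) ≤
        LinearMap.range (A t₀).mulVecLin := by
      rw [Submodule.span_le]
      rintro _ ⟨i, rfl⟩
      exact (b i).2
    obtain ⟨w, hw⟩ := hle hmem
    exact hcon ⟨w, hw⟩
  have hli := hb.option hspan
  let F : ℝ → Option (Fin (Module.finrank ℂ (LinearMap.range (A t₀).mulVecLin))) → m → ℂ :=
    fun t o => Option.casesOn' o ((t - t₀)⁻¹ • (A t *ᵥ v)) fun i => A t *ᵥ u i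
  have hlim : Filter.Tendsto F (nhdsWithin t₀ {t₀}ᶜ) (nhds
      fun o => Option.casesOn' o (A' *ᵥ v)
        fun i => ((b i : LinearMap.range (A t₀).mulVecLin) : m → ℂ)) := by
    rw [tendsto_pi_nhds]
    rintro (_ | i)
    · have := (hasDerivAt_iff_tendsto_slope.1 (hd v))
      refine this.congr fun t => ?_
      simp [slope, F, hv]
    · have := (hd (u i)).continuousAt.tendsto.mono_left (nhdsWithin_le_nhds (s := {t₀}ᶜ))
      rw [show A t₀ *ᵥ u i = b i from hu i] at this
      exact this
  obtain ⟨t, ht⟩ := (hlim.eventually hli.eventually).exists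
  have hmem : ∀ o, F t o ∈ LinearMap.range (A t).mulVecLin := by
    rintro (_ | i)
    · exact ⟨(t - t₀)⁻¹ • v, by simp [F]⟩
    · exact ⟨u i, rfl⟩
  have h1 : LinearIndependent ℂ (fun o => (⟨F t o, hmem o⟩ : LinearMap.range (A t).mulVecLin)) :=
    LinearIndependent.of_comp (Submodule.subtype _) ht
  have h2 := h1.fintype_card_le_finrank
  have h3 := hrank t
  simp only [Fintype.card_option, Fintype.card_fin] at h2
  unfold rank at h3
  omega

open scoped Matrix.Norms.Operator in
/-- Every Hermitian matrix generates a differentiable family of unitaries. -/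
theorem exists_unitary_family [DecidableEq n] {h : Matrix n n ℂ} (hh : h.IsHermitian) (t₀ : ℝ) :
    ∃ U : ℝ → Matrix n n ℂ, (∀ i j, Differentiable ℝ fun t => U t i j) ∧
      (∀ t, U t * (U t)ᴴ = 1) ∧ U t₀ = 1 ∧
      ∀ i j, HasDerivAt (fun t => U t i j) ((-(Complex.I • h)) i j) t₀ := by
  have hd : ∀ t (i j : n),
      HasDerivAt (fun s : ℝ => NormedSpace.exp ((s - t₀) • (-(Complex.I • h))) i j)
        ((NormedSpace.exp ((t - t₀) • (-(Complex.I • h))) * (-(Complex.I • h))) i j) t := by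
    intro t i j
    have h1 := (hasDerivAt_exp_smul_const (𝕂 := ℝ) (-(Complex.I • h)) (t - t₀)).scomp t
      ((hasDerivAt_id t).sub_const t₀)
    rw [one_smul] at h1
    exact (LinearMap.toContinuousLinearMap
      (Matrix.entryLinearMap ℝ ℂ i j : Matrix n n ℂ →ₗ[ℝ] ℂ)).hasFDerivAt.comp_hasDerivAt t h1
  refine ⟨fun t => NormedSpace.exp ((t - t₀) • (-(Complex.I • h))), fun i j t =>
    (hd t i j).differentiableAt, fun t => ?_, by simp, fun i j => by simpa using hd t₀ i j⟩
  rw [← exp_conjTranspose, show ((t - t₀) • (-(Complex.I • h)))ᴴ = -((t - t₀) • (-(Complex.I • h))) by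
    simp [conjTranspose_smul, hh.eq], exp_neg]
  exact mul_nonsing_inv _ ((isUnit_iff_isUnit_det _).1 (isUnit_exp _))

theorem hasDerivAt_mul_conjTranspose {m : Type*} {A : ℝ → Matrix m n ℂ} {A' : Matrix m n ℂ} {t : ℝ}
    (hA : ∀ i j, HasDerivAt (fun s => A s i j) (A' i j) t) (i j : m) :
    HasDerivAt (fun s => (A s * (A s)ᴴ) i j) ((A' * (A t)ᴴ + A t * A'ᴴ) i j) t := by
  simp only [add_apply, mul_apply, conjTranspose_apply, ← Finset.sum_add_distrib]
  exact HasDerivAt.fun_sum fun k _ => (hA i k).mul (hA j k).star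

end Matrix

/-- The purification-based QFI of a constant-rank family `A Aᴴ` is attained on the purifications
obtained from `A` by a unitary change of the ancilla. -/
theorem isLeast_QFI_mul_conjTranspose {d r : ℕ} {A : ℝ → Matrix (Fin d) (Fin r) ℂ}
    {A' : Matrix (Fin d) (Fin r) ℂ} {ρ : ℝ → Matrix (Fin d) (Fin d) ℂ} {φ₀ : ℝ}
    (hdiff : ∀ i j, Differentiable ℝ fun φ => A φ i j)
    (hA : ∀ i j, HasDerivAt (fun φ => A φ i j) (A' i j) φ₀)
    (hρ : ∀ φ, ρ φ = A φ * (A φ)ᴴ) (hrank : ∀ φ, (ρ φ).rank ≤ (ρ φ₀).rank) :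
    IsLeast { x : ℝ | ∃ h : Matrix (Fin r) (Fin r) ℂ, h.IsHermitian ∧
        x = 4 * ((A' - Complex.I • (A φ₀ * h)) * (A' - Complex.I • (A φ₀ * h))ᴴ).trace.re }
      (QFI ρ φ₀) := by
  let S : Set ℝ := { x : ℝ | ∃ (m : ℕ) (Ψ : ℝ → Fin d × Fin m → ℂ),
    (∀ i, Differentiable ℝ (fun φ => Ψ φ i)) ∧
    (∀ φ a b, (∑ k : Fin m, Ψ φ (a, k) * star (Ψ φ (b, k))) = ρ φ a b) ∧
    x = 4 * ∑ i, ‖deriv (fun φ => Ψ φ i) φ₀‖ ^ 2 }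
  have hQ : QFI ρ φ₀ = sInf S := rfl
  have hmem : ∀ h : Matrix (Fin r) (Fin r) ℂ, h.IsHermitian →
      4 * ((A' - Complex.I • (A φ₀ * h)) * (A' - Complex.I • (A φ₀ * h))ᴴ).trace.re ∈ S := by
    intro h hh
    obtain ⟨U, hUd, hU, hU0, hU'⟩ := exists_unitary_family hh φ₀
    refine ⟨r, fun φ i => (A φ * U φ) i.1 i.2, fun i => ?_, fun φ a b => ?_, ?_⟩
    · simp only [mul_apply]
      exact Differentiable.fun_sum fun k _ => (hdiff _ _).mul (hUd _ _)
    · have : A φ * U φ * (A φ * U φ)ᴴ = ρ φ := by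
        rw [conjTranspose_mul, Matrix.mul_assoc, ← Matrix.mul_assoc (U φ), hU, Matrix.one_mul, hρ]
      rw [← this]
      simp only [mul_apply, conjTranspose_apply]
    · rw [re_trace_mul_conjTranspose_self, Fintype.sum_prod_type]
      congr 1
      refine Finset.sum_congr rfl fun i _ => Finset.sum_congr rfl fun j _ => ?_
      have hd : HasDerivAt (fun φ => (A φ * U φ) i j) ((A' - Complex.I • (A φ₀ * h)) i j) φ₀ := by
        have e : A' - Complex.I • (A φ₀ * h) = A' * U φ₀ + A φ₀ * (-(Complex.I • h)) := by
          rw [hU0, Matrix.mul_one, Matrix.mul_neg, Matrix.mul_smul, sub_eq_add_neg]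
        rw [e]
        simp only [Matrix.add_apply, mul_apply, ← Finset.sum_add_distrib]
        exact HasDerivAt.fun_sum fun k _ => (hA i k).mul (hU' k j)
      rw [hd.deriv]
  obtain ⟨h₀, hh₀, hn⟩ := exists_isHermitian_normal_equation (A φ₀) A'
  have hrankA : ∀ φ, (A φ).rank ≤ (A φ₀).rank := fun φ => by
    have := hrank φ
    rwa [hρ, hρ, rank_self_mul_conjTranspose, rank_self_mul_conjTranspose] at this
  have hker : ∀ v, A φ₀ *ᵥ v = 0 → (A' - Complex.I • (A φ₀ * h₀)) *ᵥ v = 0 := by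
    intro v hv
    obtain ⟨w, hw⟩ := mulVec_deriv_mem_range_of_rank_le hA hrankA hv
    set X := A' - Complex.I • (A φ₀ * h₀) with hX
    have h1 : X *ᵥ v = A φ₀ *ᵥ (w - Complex.I • (h₀ *ᵥ v)) := by
      rw [hX, sub_mulVec, ← hw, smul_mulVec, mulVec_sub, mulVec_smul, mulVec_mulVec]
    have h2 : (A φ₀)ᴴ *ᵥ (X *ᵥ v) = 0 := by
      rw [mulVec_mulVec, ← hn.eq, conjTranspose_mul, conjTranspose_conjTranspose, ← mulVec_mulVec,
        hv, mulVec_zero]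
    rw [h1] at h2 ⊢
    rw [mulVec_mulVec] at h2
    exact (conjTranspose_mul_self_mulVec_eq_zero _ _).1 h2
  obtain ⟨L, hL, hLA⟩ := exists_isHermitian_mul_eq _ _ hn hker
  have hleast : IsLeast S
      (4 * ((A' - Complex.I • (A φ₀ * h₀)) * (A' - Complex.I • (A φ₀ * h₀))ᴴ).trace.re) := by
    refine ⟨hmem h₀ hh₀, ?_⟩
    rintro _ ⟨m, Ψ, hΨd, hΨ, rfl⟩
    let B : ℝ → Matrix (Fin d) (Fin m) ℂ := fun φ => of fun a k => Ψ φ (a, k)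
    let B' : Matrix (Fin d) (Fin m) ℂ := of fun a k => deriv (fun φ => Ψ φ (a, k)) φ₀
    have hB : ∀ φ, B φ * (B φ)ᴴ = A φ * (A φ)ᴴ := fun φ => by
      ext a b
      rw [← hρ, ← hΨ]
      rfl
    have hB' : ∀ i j, HasDerivAt (fun φ => B φ i j) (B' i j) φ₀ := fun i j =>
      (hΨd (i, j) φ₀).hasDerivAt
    have hderiv : A' * (A φ₀)ᴴ + A φ₀ * A'ᴴ = B' * (B φ₀)ᴴ + B φ₀ * B'ᴴ := by
      ext a b
      have h1 := hasDerivAt_mul_conjTranspose hB' a b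
      simp only [hB] at h1
      exact (hasDerivAt_mul_conjTranspose hA a b).unique h1
    have hle := re_trace_le_of_isHermitian L hL (A φ₀) (B φ₀) B' (hB φ₀) (by
      rw [← hderiv, hLA, conjTranspose_sub, conjTranspose_smul, conjTranspose_mul, hh₀.eq,
        Matrix.sub_mul, Matrix.mul_sub, Matrix.smul_mul, Matrix.mul_smul, Complex.star_def,
        Complex.conj_I, neg_smul, Matrix.mul_assoc]
      abel)
    rw [hLA, re_trace_mul_conjTranspose_self B'] at hle
    rw [Fintype.sum_prod_type]
    exact mul_le_mul_of_nonneg_left hle (by norm_num)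
  refine ⟨⟨h₀, hh₀, hleast.csInf_eq⟩, ?_⟩
  rintro _ ⟨h, hh, rfl⟩
  rw [hQ, hleast.csInf_eq]
  exact hleast.2 (hmem h hh)

theorem trace_ptraceF_mul_perfOp {D r dF : ℕ} (ψ : Fin D × Fin dF → ℂ)
    (C C' : Matrix (Fin D) (Fin r) ℂ) (h : Matrix (Fin r) (Fin r) ℂ)
    (S : Matrix (Fin dF) (Fin D) ℂ) (hS : S = of fun x b => ψ (b, x)) :
    (ptraceF (vecMulVec ψ (star ψ)) * perfOp C C' h).trace =
      ((4 * ((S * C' - Complex.I • (S * C * h)) *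
        (S * C' - Complex.I • (S * C * h))ᴴ).trace.re : ℝ) : ℂ) := by
  have hp : ptraceF (vecMulVec ψ (star ψ)) = (Sᴴ * S)ᵀ := by
    ext a b
    simp [ptraceF, hS, mul_apply, vecMulVec_apply, mul_comm]
  have hY : S * C' - Complex.I • (S * C * h) = S * (C' - Complex.I • (C * h)) := by
    rw [Matrix.mul_sub, Matrix.mul_smul, Matrix.mul_assoc]
  have hre : ∀ Y : Matrix (Fin dF) (Fin r) ℂ, ((Y * Yᴴ).trace.re : ℂ) = (Y * Yᴴ).trace := by
    intro Y
    rw [← Complex.conj_eq_iff_re, ← Complex.star_def, ← trace_conjTranspose, conjTranspose_mul,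
      conjTranspose_conjTranspose]
  rw [Complex.ofReal_mul, hre, hY, hp, perfOp, Matrix.mul_smul, ← transpose_mul, trace_smul,
    trace_transpose, smul_eq_mul, conjTranspose_mul, ← Matrix.mul_assoc _ Sᴴ S, trace_mul_comm _ S]
  simp only [Matrix.mul_assoc, Complex.ofReal_ofNat]

/-- For a continuously differentiable family `Cfam_φ` of `D × r` matrices (so
`C_φ = Cfam_φCfam_φ†`) and a rank-one positive semidefinite strategy `P = |P⟩⟨P|` on
`ℂ^D ⊗ H_F` whose output family `ρ_φ = ∑ᵢ (⟨C̄_{φ,i}| ⊗ I_F) P (|C̄_{φ,i}⟩ ⊗ I_F)`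
consists of density matrices of constant rank, the purification-based QFI of the output
satisfies `J(ρ_φ) = min_{h Hermitian} Tr[(Tr_F P) Ω_{φ₀}(h)]`. -/
theorem output_qfi_eq_min_perfOp {D r dF : ℕ} (φ₀ : ℝ)
    (Cfam : ℝ → Matrix (Fin D) (Fin r) ℂ)
    (hCf : ∀ a j, ContDiff ℝ 1 (fun φ => Cfam φ a j))
    (ψ : Fin D × Fin dF → ℂ)
    (P : Matrix (Fin D × Fin dF) (Fin D × Fin dF) ℂ)
    (hP : P = Matrix.vecMulVec ψ (star ψ))
    (ρ : ℝ → Matrix (Fin dF) (Fin dF) ℂ)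
    (hρ : ∀ φ, ρ φ = Matrix.of fun x y =>
      ∑ j : Fin r, ∑ b : Fin D, ∑ a : Fin D, Cfam φ b j * P (b, x) (a, y) * star (Cfam φ a j))
    (hdens : ∀ φ, (ρ φ).PosSemidef ∧ (ρ φ).trace = 1)
    (hrank : ∀ φ φ', (ρ φ).rank = (ρ φ').rank) :
    IsLeast
      { x : ℝ | ∃ h : Matrix (Fin r) (Fin r) ℂ, h.IsHermitian ∧
        (x : ℂ) = (ptraceF P *
          perfOp (Cfam φ₀) (Matrix.of fun a j => deriv (fun φ => Cfam φ a j) φ₀) h).trace }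
      (QFI ρ φ₀) := by
  let S : Matrix (Fin dF) (Fin D) ℂ := of fun x b => ψ (b, x)
  have hC : ∀ a j, Differentiable ℝ (fun φ => Cfam φ a j) := fun a j =>
    (hCf a j).differentiable one_ne_zero
  have hρS : ∀ φ, ρ φ = S * Cfam φ * (S * Cfam φ)ᴴ := fun φ => by
    ext x y
    rw [hρ, hP]
    simp only [of_apply, mul_apply, conjTranspose_apply, vecMulVec_apply, S, star_sum, star_mul',
      Finset.sum_mul_sum, Pi.star_apply]
    refine Finset.sum_congr rfl fun j _ => Finset.sum_congr rfl fun b _ =>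
      Finset.sum_congr rfl fun a _ => ?_
    ring
  have hleast := isLeast_QFI_mul_conjTranspose (A := fun φ => S * Cfam φ)
    (A' := S * of fun a j => deriv (fun φ => Cfam φ a j) φ₀) (φ₀ := φ₀)
    (fun i j => by
      simp only [mul_apply]
      exact Differentiable.fun_sum fun k _ => (hC k j).const_mul _)
    (fun i j => by
      simp only [mul_apply]
      exact HasDerivAt.fun_sum fun k _ => (hC k j φ₀).hasDerivAt.const_mul _)
    hρS (fun φ => (hrank φ φ₀).le)
  convert hleast using 5 with x h
  rw [hP, trace_ptraceF_mul_perfOp ψ _ _ h S rfl, Complex.ofReal_inj]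
end

section
/- Let Q be a Hermitian operator on H₁⊗H₂⊗⋯⊗H_{2N} (finite-dimensional complex Hilbert spaces), with d_i := dim H_i. Then Tr[Q · (I_{even} ⊗ ρ)] = 1 for every density matrix ρ on H₁⊗H₃⊗⋯⊗H_{2N−1} (where I_even is the identity on H₂⊗H₄⊗⋯⊗H_{2N}) if and only if Tr Q = ∏_{i=1}^N d_{2i−1} and _{2,4,…,2N}Q = _{1,2,…,2N}Q. Equivalently, the dual affine space of the parallel strategy marginals {I_even ⊗ ρ : ρ density matrix} consists exactly of the Hermitian Q with Tr_{even}Q = I_{odd}. -/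
open Matrix BigOperators
open scoped ComplexOrder

/-- `I_even ⊗ ρ`: the identity on the output (even) factors tensored with an operator
`ρ` on the input (odd) factors `H₁ ⊗ H₃ ⊗ ⋯ ⊗ H_{2N−1}`. -/
def idEvenTensor {N : ℕ} {p q : Fin N → ℕ}
    (ρ : Matrix ((k : Fin N) → Fin (p k)) ((k : Fin N) → Fin (p k)) ℂ) :
    Matrix (CombIdx p q) (CombIdx p q) ℂ :=
  Matrix.of fun u v =>
    ρ (fun k => (u k).1) (fun k => (v k).1) *
      (if (∀ k, (u k).2 = (v k).2) then (1 : ℂ) else 0)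

/-- The partial trace of an operator on `H₁ ⊗ ⋯ ⊗ H_{2N}` over the even factors. -/
def traceEven {N : ℕ} {p q : Fin N → ℕ} (Q : Matrix (CombIdx p q) (CombIdx p q) ℂ) :
    Matrix ((k : Fin N) → Fin (p k)) ((k : Fin N) → Fin (p k)) ℂ :=
  Matrix.of fun i j => ∑ o : (k : Fin N) → Fin (q k), Q (fun k => (i k, o k)) fun k => (j k, o k)

section
variable {N : ℕ} {p q : Fin N → ℕ}

theorem sum_combIdx {M : Type*} [AddCommMonoid M] (f : CombIdx p q → M) :
    ∑ w, f w = ∑ i : (k : Fin N) → Fin (p k), ∑ o : (k : Fin N) → Fin (q k),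
      f fun k => (i k, o k) := by
  rw [← Fintype.sum_prod_type' fun (i : (k : Fin N) → Fin (p k)) (o : (k : Fin N) → Fin (q k)) =>
    f fun k => (i k, o k)]
  exact Fintype.sum_equiv (Equiv.arrowProdEquivProdArrow _ _ _) _ _ fun _ => rfl

theorem trace_traceEven (Q : Matrix (CombIdx p q) (CombIdx p q) ℂ) :
    (traceEven Q).trace = Q.trace := by
  simp only [Matrix.trace, Matrix.diag, sum_combIdx, traceEven, Matrix.of_apply]

theorem trace_mul_idEvenTensor (Q : Matrix (CombIdx p q) (CombIdx p q) ℂ)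
    (ρ : Matrix ((k : Fin N) → Fin (p k)) ((k : Fin N) → Fin (p k)) ℂ) :
    (Q * idEvenTensor ρ).trace = (traceEven Q * ρ).trace := by
  simp only [Matrix.trace, Matrix.diag, Matrix.mul_apply, sum_combIdx, traceEven, idEvenTensor,
    Matrix.of_apply, Finset.sum_mul, ← funext_iff, mul_ite, mul_one, mul_zero,
    Finset.sum_ite_eq', Finset.mem_univ, if_true]
  exact Finset.sum_congr rfl fun i _ => Finset.sum_comm

theorem nred_even_apply (Q : Matrix (CombIdx p q) (CombIdx p q) ℂ) (u v : CombIdx p q) :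
    nred (fun _ => false) (fun _ => true) Q u v =
      (if (fun k => (u k).2) = (fun k => (v k).2) then 1 else 0) * ((∏ k, q k : ℕ) : ℂ)⁻¹ *
        traceEven Q (fun k => (u k).1) fun k => (v k).1 := by
  simp only [nred, Matrix.of_apply, sum_combIdx, traceEven]
  simp [← funext_iff]

theorem nred_all_apply (Q : Matrix (CombIdx p q) (CombIdx p q) ℂ) (u v : CombIdx p q) :
    nred (fun _ => true) (fun _ => true) Q u v =
      (if u = v then 1 else 0) * ((∏ k, p k * q k : ℕ) : ℂ)⁻¹ * Q.trace := by
  simp [nred, Matrix.trace, funext_iff, Prod.ext_iff]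

theorem traceEven_eq_one_iff (Q : Matrix (CombIdx p q) (CombIdx p q) ℂ) :
    traceEven Q = 1 ↔ Q.trace = ((∏ k, p k : ℕ) : ℂ) ∧
      nred (fun _ => false) (fun _ => true) Q = nred (fun _ => true) (fun _ => true) Q := by
  constructor
  · intro h
    have ht : Q.trace = ((∏ k, p k : ℕ) : ℂ) := by
      simp [← trace_traceEven, h, Matrix.trace_one]
    refine ⟨ht, ?_⟩
    ext u v
    have hp : ((∏ k, p k : ℕ) : ℂ) ≠ 0 :=
      Nat.cast_ne_zero.mpr (Finset.prod_ne_zero_iff.mpr fun k _ => (u k).1.pos.ne')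
    rw [nred_even_apply, nred_all_apply, h, ht, Finset.prod_mul_distrib, Nat.cast_mul, mul_inv,
      Matrix.one_apply]
    have huv : u = v ↔ (fun k => (u k).1) = (fun k => (v k).1) ∧
        (fun k => (u k).2) = fun k => (v k).2 := by
      simp only [funext_iff, Prod.ext_iff, forall_and]
    by_cases h₁ : (fun k => (u k).1) = fun k => (v k).1 <;>
      by_cases h₂ : (fun k => (u k).2) = fun k => (v k).2 <;>
      simp only [huv, h₁, h₂, and_self, and_true, and_false, if_true, if_false, one_mul, mul_one,
        zero_mul, mul_zero]
    rw [mul_right_comm, inv_mul_cancel₀ hp, one_mul]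
  · rintro ⟨ht, hn⟩
    ext i j
    rcases isEmpty_or_nonempty ((k : Fin N) → Fin (q k)) with hq | ⟨⟨o⟩⟩
    · have h₀ : Q.trace = 0 := by
        rw [← trace_traceEven]
        simp [traceEven, Matrix.trace]
      have hp : ((∏ k, p k : ℕ) : ℂ) ≠ 0 :=
        Nat.cast_ne_zero.mpr (Finset.prod_ne_zero_iff.mpr fun k _ => (i k).pos.ne')
      exact absurd (ht.symm.trans h₀) hp
    · have hp : ((∏ k, p k : ℕ) : ℂ) ≠ 0 :=
        Nat.cast_ne_zero.mpr (Finset.prod_ne_zero_iff.mpr fun k _ => (i k).pos.ne')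
      have hq : ((∏ k, q k : ℕ) : ℂ) ≠ 0 :=
        Nat.cast_ne_zero.mpr (Finset.prod_ne_zero_iff.mpr fun k _ => (o k).pos.ne')
      have huv : ((fun k => (i k, o k)) : CombIdx p q) = (fun k => (j k, o k)) ↔ i = j := by
        simp [funext_iff]
      have h := congrFun₂ hn (fun k => (i k, o k)) fun k => (j k, o k)
      rw [nred_even_apply, nred_all_apply, ht, Finset.prod_mul_distrib, Nat.cast_mul, mul_inv,
        if_pos rfl, one_mul] at h
      simp only [huv] at h
      rw [Matrix.one_apply]
      refine mul_left_cancel₀ (inv_ne_zero hq) (h.trans ?_)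
      rw [mul_assoc, mul_right_comm, inv_mul_cancel₀ hp, one_mul, mul_comm]

end

/-- A complex matrix whose quadratic form vanishes is zero. -/
theorem Matrix.eq_zero_of_forall_star_dotProduct_mulVec_eq_zero {ι : Type*} [Fintype ι]
    [DecidableEq ι] {A : Matrix ι ι ℂ} (h : ∀ v : ι → ℂ, star v ⬝ᵥ A *ᵥ v = 0) : A = 0 := by
  refine (Matrix.toEuclideanLin (𝕜 := ℂ)).map_eq_zero_iff.mp
    ((inner_map_self_eq_zero _).mp fun x => ?_)
  rw [← inner_conj_symm, EuclideanSpace.inner_eq_star_dotProduct, Matrix.ofLp_toLpLin,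
    Matrix.toLin'_apply, dotProduct_comm, h, map_zero]

/-- The identity is the only operator with unit expectation in every density matrix. -/
theorem Matrix.eq_one_iff_forall_trace_mul_eq_one {ι : Type*} [Fintype ι] [DecidableEq ι]
    {A : Matrix ι ι ℂ} :
    A = 1 ↔ ∀ ρ : Matrix ι ι ℂ, ρ.PosSemidef → ρ.trace = 1 → (A * ρ).trace = 1 := by
  refine ⟨fun h ρ _ hρ => by rw [h, one_mul, hρ], fun h => ?_⟩
  refine sub_eq_zero.mp (Matrix.eq_zero_of_forall_star_dotProduct_mulVec_eq_zero fun v => ?_)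
  rcases eq_or_ne v 0 with rfl | hv
  · simp
  have hc : 0 < star v ⬝ᵥ v := dotProduct_star_self_pos_iff.mpr hv
  have key := h ((star v ⬝ᵥ v)⁻¹ • vecMulVec v (star v))
    ((posSemidef_vecMulVec_self_star v).smul (inv_nonneg.mpr hc.le))
    (by rw [trace_smul, trace_vecMulVec, dotProduct_comm v, smul_eq_mul, inv_mul_cancel₀ hc.ne'])
  rw [Matrix.mul_smul, trace_smul, mul_vecMulVec, trace_vecMulVec, smul_eq_mul,
    inv_mul_eq_one₀ hc.ne', dotProduct_comm (A *ᵥ v)] at key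
  rw [sub_mulVec, dotProduct_sub, one_mulVec, ← key, sub_self]

/-- Characterization of the dual affine space of the parallel strategy marginals:
a Hermitian `Q` on `H₁ ⊗ ⋯ ⊗ H_{2N}` satisfies `Tr[Q (I_even ⊗ ρ)] = 1` for every
density matrix `ρ` on the odd factors if and only if `Tr Q = ∏ᵢ d_{2i−1}` and
`_{2,4,…,2N} Q = _{1,2,…,2N} Q`. -/
theorem dual_of_parallel_strategies {N : ℕ} {p q : Fin N → ℕ}
    (Q : Matrix (CombIdx p q) (CombIdx p q) ℂ) (hQ : Q.IsHermitian) :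
    (∀ ρ : Matrix ((k : Fin N) → Fin (p k)) ((k : Fin N) → Fin (p k)) ℂ,
        ρ.PosSemidef → ρ.trace = 1 → (Q * idEvenTensor ρ).trace = 1)
      ↔ (Q.trace = ((∏ k, p k : ℕ) : ℂ) ∧
          nred (fun _ => false) (fun _ => true) Q = nred (fun _ => true) (fun _ => true) Q) := by
  simp only [trace_mul_idEvenTensor]
  rw [← Matrix.eq_one_iff_forall_trace_mul_eq_one, traceEven_eq_one_iff]
end

section
/- Let P̃ be a positive semidefinite matrix on ℂ^D and 𝐂, 𝐃 fixed D×r complex matrices, and define g(h) := Tr[P̃ · 4((𝐃 − i𝐂h)(𝐃 − i𝐂h)†)^T] on the real vector space of r×r Hermitian matrices h. Then h₀ is a global minimizer of g if and only if the r×r matrix 𝐂† P̃^T (𝐃 − i𝐂h₀) is Hermitian. -/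
open Matrix BigOperators
open scoped ComplexOrder

/-- The objective `g(h) = Tr[P̃ · 4((𝐃 − i𝐂h)(𝐃 − i𝐂h)†)ᵀ]` on Hermitian `h`. -/
noncomputable def objFn {n r : ℕ} (P : Matrix (Fin n) (Fin n) ℂ)
    (C D : Matrix (Fin n) (Fin r) ℂ) (h : Matrix (Fin r) (Fin r) ℂ) : ℝ :=
  ((P * ((4 : ℂ) • (((D - Complex.I • (C * h)) * (D - Complex.I • (C * h))ᴴ)ᵀ))).trace).re

lemma objFn_eq_trace {n r : ℕ} (P : Matrix (Fin n) (Fin n) ℂ)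
    (C D : Matrix (Fin n) (Fin r) ℂ) (h : Matrix (Fin r) (Fin r) ℂ) :
    objFn P C D h
      = 4 * (((D - Complex.I • (C * h))ᴴ * Pᵀ * (D - Complex.I • (C * h))).trace).re := by
  unfold objFn
  generalize D - Complex.I • (C * h) = M
  have key : (P * (M * Mᴴ)ᵀ).trace = (Mᴴ * Pᵀ * M).trace := by
    rw [← trace_transpose, transpose_mul, transpose_transpose, Matrix.mul_assoc, trace_mul_comm]
  rw [Matrix.mul_smul, trace_smul, key]
  simp

/-- Second-order expansion of the objective around a Hermitian point, which is exact. -/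
lemma objFn_add {n r : ℕ} {P : Matrix (Fin n) (Fin n) ℂ} (hP : P.IsHermitian)
    (C D : Matrix (Fin n) (Fin r) ℂ) (h₀ : Matrix (Fin r) (Fin r) ℂ)
    {k : Matrix (Fin r) (Fin r) ℂ} (hk : k.IsHermitian) :
    objFn P C D (h₀ + k) = objFn P C D h₀
      - 8 * ((k * (Cᴴ * Pᵀ * (D - Complex.I • (C * h₀)))).trace).im
      + 4 * (((C * k)ᴴ * Pᵀ * (C * k)).trace).re := by
  have hQ : (Pᵀ)ᴴ = Pᵀ := hP.transpose
  rw [objFn_eq_trace, objFn_eq_trace]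
  have hM : D - Complex.I • (C * (h₀ + k))
      = (D - Complex.I • (C * h₀)) - Complex.I • (C * k) := by
    rw [Matrix.mul_add, smul_add, sub_add_eq_sub_sub]
  rw [hM]
  generalize D - Complex.I • (C * h₀) = A
  generalize Pᵀ = Q at *
  have hswap : (Aᴴ * Q * (C * k)).trace = star ((k * (Cᴴ * Q * A)).trace) := by
    rw [← trace_conjTranspose]
    simp only [conjTranspose_mul, conjTranspose_conjTranspose, hk.eq, hQ, Matrix.mul_assoc]
  have hcross : ((C * k)ᴴ * Q * A).trace = (k * (Cᴴ * Q * A)).trace := by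
    simp only [conjTranspose_mul, hk.eq, Matrix.mul_assoc]
  simp only [conjTranspose_sub, conjTranspose_smul, Matrix.sub_mul, Matrix.mul_sub,
    Matrix.smul_mul, Matrix.mul_smul, trace_sub, trace_smul, hswap, hcross]
  simp
  ring

lemma Matrix.IsHermitian.im_trace_mul_eq_zero {m : Type*} [Fintype m] {k S : Matrix m m ℂ}
    (hk : k.IsHermitian) (hS : S.IsHermitian) : ((k * S).trace).im = 0 := by
  have h : star ((k * S).trace) = (k * S).trace := by
    rw [← trace_conjTranspose, conjTranspose_mul, hk.eq, hS.eq, trace_mul_comm]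
  exact Complex.conj_eq_iff_im.mp h

lemma Matrix.isHermitian_of_im_trace_mul_eq_zero {m : Type*} [Fintype m] {S : Matrix m m ℂ}
    (hS : ∀ k : Matrix m m ℂ, k.IsHermitian → ((k * S).trace).im = 0) : S.IsHermitian := by
  have hk : (Complex.I • (S - Sᴴ)).IsHermitian := by
    simp [IsHermitian, conjTranspose_smul, conjTranspose_sub, smul_sub, neg_add_eq_sub]
  have h := hS _ hk
  rw [Matrix.smul_mul, trace_smul, smul_eq_mul, Complex.I_mul_im] at h
  have hstar : ((S - Sᴴ) * Sᴴ).trace = - star (((S - Sᴴ) * S).trace) := by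
    rw [← trace_conjTranspose, conjTranspose_mul, trace_mul_comm, conjTranspose_sub,
      conjTranspose_conjTranspose, ← trace_neg, ← Matrix.mul_neg, neg_sub]
  have hre : (((S - Sᴴ)ᴴ * (S - Sᴴ)).trace).re = 0 := by
    have hT : (S - Sᴴ)ᴴ = -(S - Sᴴ) := by simp
    rw [hT, Matrix.neg_mul, Matrix.mul_sub, trace_neg, trace_sub, hstar]
    simp [h]
  have hnonneg := (posSemidef_conjTranspose_mul_self (S - Sᴴ)).trace_nonneg
  have hzero : ((S - Sᴴ)ᴴ * (S - Sᴴ)).trace = 0 :=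
    Complex.ext hre (Complex.le_def.mp hnonneg).2.symm
  exact (sub_eq_zero.mp (trace_conjTranspose_mul_self_eq_zero_iff.mp hzero)).symm

lemma eq_zero_of_forall_mul_le_mul_sq {b c : ℝ} (hc : 0 ≤ c)
    (h : ∀ t : ℝ, t * b ≤ t ^ 2 * c) : b = 0 := by
  have hpos : 0 < c + 1 := by linarith
  have h1 := h (b / (c + 1))
  have h2 : (b / (c + 1)) ^ 2 * c - b / (c + 1) * b = -(b / (c + 1)) ^ 2 := by
    field_simp
    ring
  have h3 : b / (c + 1) = 0 := by
    have : (b / (c + 1)) ^ 2 ≤ 0 := by linarith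
    exact pow_eq_zero_iff two_ne_zero |>.mp (le_antisymm this (sq_nonneg _))
  exact (div_eq_zero_iff.mp h3).resolve_right hpos.ne'

/-- Stationarity characterization of optimal strategies: for `P̃ ≥ 0` and fixed `D × r`
matrices `𝐂`, `𝐃`, a Hermitian `h₀` is a global minimizer (over Hermitian matrices) of
`g(h) = Tr[P̃ · 4((𝐃 − i𝐂h)(𝐃 − i𝐂h)†)ᵀ]` if and only if `𝐂† P̃ᵀ (𝐃 − i𝐂h₀)` is
Hermitian. -/
theorem minimizer_iff_hermitian {n r : ℕ}
    (P : Matrix (Fin n) (Fin n) ℂ) (hP : P.PosSemidef)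
    (C D : Matrix (Fin n) (Fin r) ℂ)
    (h₀ : Matrix (Fin r) (Fin r) ℂ) (hh₀ : h₀.IsHermitian) :
    (∀ h : Matrix (Fin r) (Fin r) ℂ, h.IsHermitian → objFn P C D h₀ ≤ objFn P C D h)
      ↔ (Cᴴ * Pᵀ * (D - Complex.I • (C * h₀))).IsHermitian := by
  have hquad (k : Matrix (Fin r) (Fin r) ℂ) : 0 ≤ (((C * k)ᴴ * Pᵀ * (C * k)).trace).re :=
    (Complex.le_def.mp (hP.transpose.conjTranspose_mul_mul_same (C * k)).trace_nonneg).1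
  constructor
  · intro hmin
    refine isHermitian_of_im_trace_mul_eq_zero fun k hk => ?_
    have key : 2 * ((k * (Cᴴ * Pᵀ * (D - Complex.I • (C * h₀)))).trace).im = 0 := by
      refine eq_zero_of_forall_mul_le_mul_sq (hquad k) fun t => ?_
      have htk : ((t : ℂ) • k).IsHermitian := by
        simp [IsHermitian, conjTranspose_smul, hk.eq]
      have h := hmin (h₀ + (t : ℂ) • k) (hh₀.add htk)
      rw [objFn_add hP.isHermitian C D h₀ htk] at h
      simp only [Matrix.mul_smul, Matrix.smul_mul, conjTranspose_smul, trace_smul, smul_eq_mul,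
        Complex.star_def, Complex.conj_ofReal, Complex.re_ofReal_mul, Complex.im_ofReal_mul] at h
      linarith
    linarith
  · intro hS h hh
    have hk : (h - h₀).IsHermitian := hh.sub hh₀
    have hexp := objFn_add hP.isHermitian C D h₀ hk
    rw [add_sub_cancel, hk.im_trace_mul_eq_zero hS] at hexp
    linarith [hquad (h - h₀)]
end
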